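/- Let G be a finite non-abelian group whose order is coprime with 6. Then there exist a bicyclic unit β of ℤG, a Bass cyclic unit u of ℤG, and a positive integer T such that for every integer t ≥ T, the pair (u, β^t) is a free pair in the unit group of ℤG. -/

import Mathlib

/-- `u` and `v` form a free pair. -/
def IsFreePair {G : Type*} [Group G] (u v : G) : Prop :=
  Function.Injective ((FreeGroup.lift (fun b : Bool => if b then u else v)) : FreeGroup Bool →* G)

/-- `ĥ = 1 + h + h² + ⋯ + h^{d-1}` in `ℤG`, where `d` is the order of `h`. -/
noncomputable def hat {G : Type*} [Group G] (h : G) : MonoidAlgebra ℤ G :=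
  ∑ i ∈ Finset.range (orderOf h), (MonoidAlgebra.of ℤ G h) ^ i

/-- The bicyclic unit `β_{x,h} = 1 + (1 − h)·x·ĥ` of `ℤG`. -/
noncomputable def bicyclicBeta {G : Type*} [Group G] (x h : G) : MonoidAlgebra ℤ G :=
  1 + (1 - MonoidAlgebra.of ℤ G h) * MonoidAlgebra.of ℤ G x * hat h

/-- The bicyclic unit `γ_{x,h} = 1 + ĥ·x·(1 − h)` of `ℤG`. -/
noncomputable def bicyclicGamma {G : Type*} [Group G] (x h : G) : MonoidAlgebra ℤ G :=
  1 + hat h * MonoidAlgebra.of ℤ G x * (1 - MonoidAlgebra.of ℤ G h)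

/-- `u ∈ ℤG` is a bicyclic unit (of either type). -/
def IsBicyclicUnit {G : Type*} [Group G] (u : MonoidAlgebra ℤ G) : Prop :=
  ∃ x h : G, u = bicyclicBeta x h ∨ u = bicyclicGamma x h

/-- The Bass cyclic unit
`u_{k,m}(x) = (1 + x + ⋯ + x^{k-1})^m + ((1 − k^m)/d)·(1 + x + ⋯ + x^{d-1})`
of `ℤG`, where `d` is the order of `x`. -/
noncomputable def bassCyclic {G : Type*} [Group G] (x : G) (k m : ℕ) : MonoidAlgebra ℤ G :=
  (∑ i ∈ Finset.range k, (MonoidAlgebra.of ℤ G x) ^ i) ^ m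
    + ((1 - (k : ℤ) ^ m) / (orderOf x : ℤ)) •
        ∑ i ∈ Finset.range (orderOf x), (MonoidAlgebra.of ℤ G x) ^ i

/-- `u ∈ ℤG` is a Bass cyclic unit: `u = u_{k,m}(x)` with `gcd(k, d) = 1` and `φ(d) ∣ m`,
where `d` is the order of `x`. -/
def IsBassCyclicUnit {G : Type*} [Group G] (u : MonoidAlgebra ℤ G) : Prop :=
  ∃ (x : G) (k m : ℕ), 0 < k ∧ 0 < m ∧ Nat.Coprime k (orderOf x) ∧
    (orderOf x).totient ∣ m ∧ u = bassCyclic x k m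

open scoped Pointwise in
/-- Ping-pong for two elements, all powers at once. -/
theorem freePair_of_pingpong {Γ α : Type*} [Group Γ] [MulAction Γ α] (u v : Γ) (X Y : Set α)
    (hX : X.Nonempty) (hY : Y.Nonempty) (hXY : Disjoint X Y)
    (hu : ∀ n : ℤ, n ≠ 0 → ∀ x ∈ Y, u ^ n • x ∈ X)
    (hv : ∀ n : ℤ, n ≠ 0 → ∀ x ∈ X, v ^ n • x ∈ Y) : IsFreePair u v := by
  unfold IsFreePair
  set a : Bool → Γ := fun b : Bool => if b then u else v with ha
  have : FreeGroup.lift a =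
      (Monoid.CoprodI.lift fun i => FreeGroup.lift fun _ => a i).comp
        (@freeGroupEquivCoprodI Bool).toMonoidHom := by
    ext i
    simp
  rw [this, MonoidHom.coe_comp]
  clear this
  refine Function.Injective.comp ?_ (MulEquiv.injective freeGroupEquivCoprodI)
  change Function.Injective
    (Monoid.CoprodI.lift fun i : Bool => FreeGroup.lift fun _ => a i)
  let H : Bool → Type _ := fun _i => FreeGroup Unit
  let f : ∀ i, H i →* Γ := fun i => FreeGroup.lift fun _ => a i
  let X' : Bool → Set α := fun i => if i then X else Y
  apply Monoid.CoprodI.lift_injective_of_ping_pong f _ X'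
  · intro i
    cases i
    · exact hY
    · exact hX
  · intro i j hij
    cases i <;> cases j
    · exact absurd rfl hij
    · exact hXY.symm
    · exact hXY
    · exact absurd rfl hij
  · change Pairwise fun i j => ∀ h : H i, h ≠ 1 → f i h • X' j ⊆ X' i
    rintro i j hij
    refine FreeGroup.freeGroupUnitEquivInt.forall_congr_left.mpr ?_
    intro n hne1
    change FreeGroup.lift (fun _ => a i) (FreeGroup.of () ^ n) • X' j ⊆ X' i
    simp only [map_zpow, FreeGroup.lift_apply_of]
    have hnne0 : n ≠ 0 := by
      rintro rfl
      apply hne1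
      simp [H, FreeGroup.freeGroupUnitEquivInt]
    rintro _ ⟨x, hx, rfl⟩
    cases i <;> cases j
    · exact absurd rfl hij
    · exact hv n hnne0 x hx
    · exact hu n hnne0 x hx
    · exact absurd rfl hij
  · right
    use true
    simp only [H]
    rw [FreeGroup.freeGroupUnitEquivInt.cardinal_eq, Cardinal.mk_denumerable]
    exact Cardinal.natCast_le_aleph0

/-- Quantitative criterion: a transvection `β` and an element `u` all of whose nontrivial powers
move the direction `w₁` away from the kernel of `φ`. -/
theorem freePair_of_transvection {Γ α E : Type*} [Group Γ] [MulAction Γ α]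
    [NormedAddCommGroup E] [NormedSpace ℂ E] (u β : Γ) (M : Set α) (ev : α → E)
    (φ : E →ₗ[ℂ] ℂ) (w₁ : E) (D : ℤ → E →ₗ[ℂ] E) (L : ℤ → ℝ) (B c : ℝ)
    (hMu : ∀ n : ℤ, ∀ x ∈ M, u ^ n • x ∈ M)
    (hMβ : ∀ n : ℤ, ∀ x ∈ M, β ^ n • x ∈ M)
    (hβ : ∀ n : ℤ, ∀ x ∈ M, ev (β ^ n • x) = ev x + ((n : ℂ) * φ (ev x)) • w₁)
    (hu : ∀ n : ℤ, ∀ x ∈ M, ev (u ^ n • x) = D n (ev x))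
    (hφw : φ w₁ = 0) (hB : 0 < B) (hφ : ∀ e, ‖φ e‖ ≤ B * ‖e‖)
    (hL : ∀ n, 0 < L n) (hD : ∀ n : ℤ, n ≠ 0 → ∀ e, ‖D n e‖ ≤ L n * ‖e‖)
    (hc : 0 < c) (hκ : ∀ n : ℤ, n ≠ 0 → c * L n ≤ ‖φ (D n w₁)‖)
    (x₀ : α) (hx₀ : x₀ ∈ M) (hevx₀ : ev x₀ = w₁) :
    ∃ T : ℕ, 0 < T ∧ ∀ t : ℕ, T ≤ t → IsFreePair u (β ^ t) := by
  have hw : w₁ ≠ 0 := by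
    rintro rfl
    have := hκ 1 one_ne_zero
    simp at this
    nlinarith [hL 1]
  have hw' : 0 < ‖w₁‖ := norm_pos_iff.2 hw
  set δ : ℝ := min (‖w₁‖ / 2) (c / (8 * B)) with hδ
  have hδ0 : 0 < δ := by positivity
  have hδ1 : δ ≤ ‖w₁‖ / 2 := min_le_left _ _
  have hδ2 : B * δ ≤ c / 8 := by
    have : δ ≤ c / (8 * B) := min_le_right _ _
    rw [le_div_iff₀ (by positivity)] at this
    linarith
  set η : ℝ := c / (3 * ‖w₁‖) with hη
  have hη0 : 0 < η := by positivity
  have hηw : η * ‖w₁‖ = c / 3 := by rw [hη]; field_simp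
  obtain ⟨T, hT⟩ := exists_nat_gt (1 / (η * δ))
  have hT0 : (0 : ℝ) < T := lt_trans (by positivity) hT
  have hT0' : 0 < T := by exact_mod_cast hT0
  refine ⟨T, hT0', fun t ht => ?_⟩
  let X : Set α := {x | x ∈ M ∧ ev x ≠ 0 ∧ η * ‖ev x‖ ≤ ‖φ (ev x)‖}
  let Y : Set α := {x | x ∈ M ∧ ∃ s : ℂ, s ≠ 0 ∧ ‖ev x - s • w₁‖ ≤ δ * ‖s‖}
  have hYne : x₀ ∈ Y := ⟨hx₀, 1, one_ne_zero, by rw [hevx₀]; simpa using hδ0.le⟩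
  have huXY : ∀ n : ℤ, n ≠ 0 → ∀ x ∈ Y, u ^ n • x ∈ X := by
    rintro n hn x ⟨hxM, s, hs, hxs⟩
    have hs0 : 0 < ‖s‖ := norm_pos_iff.2 hs
    obtain ⟨r, hr⟩ : ∃ r, r = ev x - s • w₁ := ⟨_, rfl⟩
    have hex : ev x = s • w₁ + r := by rw [hr]; abel
    rw [← hr] at hxs
    have h1 : ‖φ (D n r)‖ ≤ B * (L n * (δ * ‖s‖)) := by
      refine (hφ _).trans (mul_le_mul_of_nonneg_left ?_ hB.le)
      exact (hD n hn r).trans (mul_le_mul_of_nonneg_left hxs (hL n).le)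
    have h2 : ‖s‖ * (c * L n) - B * (L n * (δ * ‖s‖)) ≤ ‖φ (D n (ev x))‖ := by
      rw [hex, map_add, map_add, map_smul, map_smul]
      have h3 : ‖s • φ (D n w₁)‖ - ‖φ (D n r)‖ ≤ ‖s • φ (D n w₁) + φ (D n r)‖ := by
        have := norm_sub_le (s • φ (D n w₁) + φ (D n r)) (φ (D n r))
        rw [add_sub_cancel_right] at this
        linarith
      have h4 : ‖s‖ * (c * L n) ≤ ‖s • φ (D n w₁)‖ := by
        rw [norm_smul]
        exact mul_le_mul_of_nonneg_left (hκ n hn) hs0.le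
      linarith
    have hsL : 0 < ‖s‖ * L n := mul_pos hs0 (hL n)
    have h5 : (c / 2) * (‖s‖ * L n) ≤ ‖φ (D n (ev x))‖ := by nlinarith
    have h6 : ‖D n (ev x)‖ ≤ (3 / 2 * ‖w₁‖) * (‖s‖ * L n) := by
      refine (hD n hn _).trans ?_
      have h7 : ‖ev x‖ ≤ ‖s‖ * ‖w₁‖ + δ * ‖s‖ := by
        rw [hex]
        refine (norm_add_le _ _).trans ?_
        rw [norm_smul]
        linarith
      have h8 : ‖ev x‖ ≤ 3 / 2 * ‖w₁‖ * ‖s‖ := by nlinarith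
      nlinarith [hL n]
    refine ⟨hMu n x hxM, ?_, ?_⟩
    · rw [hu n x hxM]
      intro h0
      rw [h0, map_zero, norm_zero] at h5
      have : 0 < (c / 2) * (‖s‖ * L n) := by positivity
      linarith
    · rw [hu n x hxM]
      calc η * ‖D n (ev x)‖ ≤ η * ((3 / 2 * ‖w₁‖) * (‖s‖ * L n)) :=
            mul_le_mul_of_nonneg_left h6 hη0.le
        _ = (3 / 2) * (η * ‖w₁‖) * (‖s‖ * L n) := by ring
        _ = (c / 2) * (‖s‖ * L n) := by rw [hηw]; ring
        _ ≤ _ := h5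
  refine freePair_of_pingpong u (β ^ t) X Y ⟨_, huXY 1 one_ne_zero x₀ hYne⟩ ⟨x₀, hYne⟩ ?_ huXY ?_
  · rw [Set.disjoint_left]
    rintro x ⟨-, -, hx⟩ ⟨-, s, hs, hxs⟩
    have hs0 : 0 < ‖s‖ := norm_pos_iff.2 hs
    have h1 : ‖φ (ev x)‖ ≤ B * (δ * ‖s‖) := by
      have : φ (ev x) = φ (ev x - s • w₁) := by rw [map_sub, map_smul, hφw]; simp
      rw [this]
      exact (hφ _).trans (mul_le_mul_of_nonneg_left hxs hB.le)
    have h2 : ‖s‖ * ‖w₁‖ - δ * ‖s‖ ≤ ‖ev x‖ := by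
      have h3 := norm_sub_norm_le (s • w₁) (s • w₁ - ev x)
      rw [norm_smul, sub_sub_cancel, norm_sub_rev] at h3
      linarith
    have h4 : ‖s‖ * ‖w₁‖ / 2 ≤ ‖ev x‖ := by nlinarith
    have h5 : η * (‖s‖ * ‖w₁‖ / 2) ≤ η * ‖ev x‖ := mul_le_mul_of_nonneg_left h4 hη0.le
    have h6 : η * (‖s‖ * ‖w₁‖ / 2) = c / 6 * ‖s‖ := by
      calc _ = (η * ‖w₁‖) * ‖s‖ / 2 := by ring
        _ = _ := by rw [hηw]; ring
    nlinarith [mul_pos hc hs0]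
  · rintro n hn x ⟨hxM, hx0, hx⟩
    have hpow : (β ^ t) ^ n = β ^ ((t : ℤ) * n) := by rw [zpow_mul, zpow_natCast]
    rw [hpow]
    have hx1 : 0 < ‖φ (ev x)‖ := lt_of_lt_of_le (mul_pos hη0 (norm_pos_iff.2 hx0)) hx
    have htT : (T : ℝ) ≤ t := by exact_mod_cast ht
    have hn1 : (1 : ℝ) ≤ ‖(n : ℂ)‖ := by
      rw [Complex.norm_intCast]
      exact_mod_cast Int.one_le_abs hn
    have hst : ‖(((t : ℤ) * n : ℤ) : ℂ) * φ (ev x)‖ = t * ‖(n : ℂ)‖ * ‖φ (ev x)‖ := by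
      push_cast
      rw [norm_mul, norm_mul, Complex.norm_natCast]
    refine ⟨hMβ _ x hxM, (((t : ℤ) * n : ℤ) : ℂ) * φ (ev x), ?_, ?_⟩
    · rw [← norm_pos_iff, hst]
      have : (0 : ℝ) < t := lt_of_lt_of_le hT0 htT
      positivity
    · rw [hβ _ x hxM, add_sub_cancel_right, hst]
      have h1 : 1 ≤ η * δ * t := by
        rw [div_lt_iff₀ (by positivity)] at hT
        nlinarith [mul_pos hη0 hδ0]
      have h2 : ‖ev x‖ ≤ η * δ * t * ‖ev x‖ := by nlinarith [norm_nonneg (ev x)]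
      have h3 : δ * t * (η * ‖ev x‖) ≤ δ * t * ‖φ (ev x)‖ :=
        mul_le_mul_of_nonneg_left hx (by positivity)
      have h4 : δ * t * ‖φ (ev x)‖ * 1 ≤ δ * t * ‖φ (ev x)‖ * ‖(n : ℂ)‖ :=
        mul_le_mul_of_nonneg_left hn1 (by positivity)
      linarith


/-- Dominant term lemma. -/
theorem dominant_term {ι : Type*} [Fintype ι] (c : ι → ℂ) (r : ι → ℝ) (M : ℝ)
    (hM : 0 < M) (hr0 : ∀ i, 0 < r i) (hr : ∀ i, r i ≤ M)
    (hK : (∑ i with r i = M, c i) ≠ 0) :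
    ∃ N₀ : ℕ, ∀ N ≥ N₀, ‖∑ i with r i = M, c i‖ / 2 * M ^ N ≤ ‖∑ i, c i * (r i : ℂ) ^ N‖ := by
  have key : Filter.Tendsto (fun N : ℕ => ∑ i, c i * ((r i / M : ℝ) : ℂ) ^ N) Filter.atTop
      (nhds (∑ i, if r i = M then c i else 0)) := by
    refine tendsto_finsetSum _ fun i _ => ?_
    split_ifs with h
    · rw [h, div_self hM.ne']
      simp
    · have hlt : ‖((r i / M : ℝ) : ℂ)‖ < 1 := by
        rw [Complex.norm_real, Real.norm_of_nonneg (div_nonneg (hr0 i).le hM.le), div_lt_one hM]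
        exact lt_of_le_of_ne (hr i) h
      have := (tendsto_pow_atTop_nhds_zero_of_norm_lt_one hlt).const_mul (c i)
      simpa using this
  rw [← Finset.sum_filter] at key
  have hlt : ‖∑ i with r i = M, c i‖ / 2 < ‖∑ i with r i = M, c i‖ :=
    half_lt_self (norm_pos_iff.2 hK)
  obtain ⟨N₀, hN₀⟩ := Filter.eventually_atTop.1 (key.norm.eventually_const_lt hlt)
  refine ⟨N₀, fun N hN => ?_⟩
  have h1 := hN₀ N hN
  have h2 : (∑ i, c i * (r i : ℂ) ^ N) = (∑ i, c i * ((r i / M : ℝ) : ℂ) ^ N) * (M : ℂ) ^ N := by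
    rw [Finset.sum_mul]
    refine Finset.sum_congr rfl fun i _ => ?_
    rw [mul_assoc, ← mul_pow, ← Complex.ofReal_mul, div_mul_cancel₀ _ hM.ne']
  rw [h2, norm_mul, norm_pow, Complex.norm_real, Real.norm_of_nonneg hM.le]
  exact mul_le_mul_of_nonneg_right h1.le (by positivity)

/-- Both ends of the spectrum at once: bounds for all nonzero integer exponents. -/
theorem dominant_both {ι : Type*} [Fintype ι] (c : ι → ℂ) (r : ι → ℝ) (M m : ℝ)
    (hm : 0 < m) (hM : 0 < M) (hr0 : ∀ i, m ≤ r i) (hr : ∀ i, r i ≤ M)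
    (hK : (∑ i with r i = M, c i) ≠ 0) (hK' : (∑ i with r i = m, c i) ≠ 0) :
    ∃ c₀ : ℝ, 0 < c₀ ∧ ∃ N₀ : ℕ, ∀ N ≥ N₀, ∀ n : ℤ, n ≠ 0 →
      c₀ * (if 0 ≤ n then (M ^ N) ^ n else (m ^ N) ^ n) ≤
        ‖∑ i, c i * (((r i) ^ N : ℝ) : ℂ) ^ n‖ := by
  have hrp : ∀ i, 0 < r i := fun i => lt_of_lt_of_le hm (hr0 i)
  obtain ⟨N₁, h₁⟩ := dominant_term c r M hM hrp hr hK
  have hset : ∀ i, ((r i)⁻¹ = m⁻¹) ↔ (r i = m) := fun i => inv_inj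
  obtain ⟨N₂, h₂⟩ := dominant_term c (fun i => (r i)⁻¹) m⁻¹ (inv_pos.2 hm)
    (fun i => inv_pos.2 (hrp i)) (fun i => inv_anti₀ hm (hr0 i)) (by simpa only [hset] using hK')
  simp only [hset] at h₂
  refine ⟨min (‖∑ i with r i = M, c i‖ / 2) (‖∑ i with r i = m, c i‖ / 2),
    lt_min (half_pos (norm_pos_iff.2 hK)) (half_pos (norm_pos_iff.2 hK')),
    max N₁ N₂, fun N hN n hn => ?_⟩
  rcases lt_or_gt_of_ne hn with hneg | hpos
  · obtain ⟨k, hk⟩ : ∃ k : ℕ, n = -(k : ℤ) := ⟨n.natAbs, by omega⟩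
    subst hk
    have hk1 : 1 ≤ k := by omega
    have hN2 : N * k ≥ N₂ := le_trans (le_trans (le_max_right _ _) hN) (Nat.le_mul_of_pos_right _ hk1)
    rw [if_neg (by omega)]
    have h3 := h₂ (N * k) hN2
    have e1 : (m ^ N) ^ (-(k : ℤ)) = m⁻¹ ^ (N * k) := by
      rw [zpow_neg, zpow_natCast, ← pow_mul, inv_pow]
    have e2 : ∀ i, (((r i) ^ N : ℝ) : ℂ) ^ (-(k : ℤ)) = (((r i)⁻¹ : ℝ) : ℂ) ^ (N * k) := by
      intro i
      rw [zpow_neg, zpow_natCast]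
      push_cast
      rw [← pow_mul, inv_pow]
    simp only [e1, e2]
    refine le_trans (mul_le_mul_of_nonneg_right (min_le_right _ _) (by positivity)) h3
  · obtain ⟨k, hk⟩ : ∃ k : ℕ, n = (k : ℤ) := ⟨n.natAbs, by omega⟩
    subst hk
    have hk1 : 1 ≤ k := by omega
    have hN2 : N * k ≥ N₁ := le_trans (le_trans (le_max_left _ _) hN) (Nat.le_mul_of_pos_right _ hk1)
    rw [if_pos (by omega)]
    have h3 := h₁ (N * k) hN2
    have e1 : (M ^ N) ^ (k : ℤ) = M ^ (N * k) := by
      rw [zpow_natCast, ← pow_mul]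
    have e2 : ∀ i, (((r i) ^ N : ℝ) : ℂ) ^ (k : ℤ) = ((r i : ℝ) : ℂ) ^ (N * k) := by
      intro i
      rw [zpow_natCast]
      push_cast
      rw [← pow_mul]
    simp only [e1, e2]
    refine le_trans (mul_le_mul_of_nonneg_right (min_le_left _ _) (by positivity)) h3

/-- Galois argument: a vanishing sum `∑ (θ - θ')` of `p`-th roots of unity with no `θ = 1`
has no `θ' = 1`. -/
theorem galois_argument {ι : Type*} (S : Finset ι) (p : ℕ) (hp : p.Prime) (θ θ' : ι → ℂ)
    (hθ : ∀ i ∈ S, θ i ^ p = 1) (hθ' : ∀ i ∈ S, θ' i ^ p = 1)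
    (h1 : ∀ i ∈ S, θ i ≠ 1) (hK : ∑ i ∈ S, (θ i - θ' i) = 0) : ∀ i ∈ S, θ' i ≠ 1 := by
  classical
  have hp0 : p ≠ 0 := hp.ne_zero
  have : NeZero p := ⟨hp0⟩
  set ω : ℂ := Complex.exp (2 * Real.pi * Complex.I / p) with hω
  have hprim : IsPrimitiveRoot ω p := Complex.isPrimitiveRoot_exp p hp0
  have ha : ∀ i, ∃ a : ℕ, i ∈ S → θ i = ω ^ a := fun i => by
    by_cases hi : i ∈ S
    · obtain ⟨a, -, h⟩ := hprim.eq_pow_of_pow_eq_one (hθ i hi)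
      exact ⟨a, fun _ => h.symm⟩
    · exact ⟨0, fun h => absurd h hi⟩
  have hb : ∀ i, ∃ a : ℕ, i ∈ S → θ' i = ω ^ a := fun i => by
    by_cases hi : i ∈ S
    · obtain ⟨a, -, h⟩ := hprim.eq_pow_of_pow_eq_one (hθ' i hi)
      exact ⟨a, fun _ => h.symm⟩
    · exact ⟨0, fun h => absurd h hi⟩
  choose a ha using ha
  choose b hb using hb
  let F : Polynomial ℤ := ∑ i ∈ S, (Polynomial.X ^ a i - Polynomial.X ^ b i)
  have hFω : Polynomial.aeval ω F = 0 := by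
    simp only [F, map_sum, map_sub, map_pow, Polynomial.aeval_X]
    rw [← hK]
    exact Finset.sum_congr rfl fun i hi => by rw [ha i hi, hb i hi]
  have hint : IsIntegral ℤ ω := hprim.isIntegral hp.pos
  have hdvd : minpoly ℤ ω ∣ F := minpoly.isIntegrallyClosed_dvd hint hFω
  have hFj : ∀ j : ℕ, j < p → Polynomial.aeval (ω ^ j) F = 0 := by
    intro j hj
    rcases Nat.eq_zero_or_pos j with rfl | hj0
    · simp [F]
    · have hcop : Nat.Coprime j p := (Nat.coprime_of_lt_prime hj0.ne' hj hp).symm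
      have h2 := hprim.minpoly_eq_pow_coprime hcop
      rw [h2] at hdvd
      obtain ⟨Q, hQ⟩ := hdvd
      rw [hQ, map_mul, minpoly.aeval, zero_mul]
  have hsum : ∑ j ∈ Finset.range p, Polynomial.aeval (ω ^ j) F = 0 :=
    Finset.sum_eq_zero fun j hj => hFj j (Finset.mem_range.1 hj)
  have hgeom : ∀ z : ℂ, z ^ p = 1 → ∑ j ∈ Finset.range p, z ^ j = if z = 1 then (p : ℂ) else 0 := by
    intro z hz
    split_ifs with h
    · simp [h]
    · rw [geom_sum_eq h, hz, sub_self, zero_div]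
  have hexp : ∑ j ∈ Finset.range p, Polynomial.aeval (ω ^ j) F
      = ∑ i ∈ S, ((if θ i = 1 then (p : ℂ) else 0) - (if θ' i = 1 then (p : ℂ) else 0)) := by
    simp only [F, map_sum, map_sub, map_pow, Polynomial.aeval_X]
    rw [Finset.sum_comm]
    refine Finset.sum_congr rfl fun i hi => ?_
    rw [Finset.sum_sub_distrib, ← hgeom _ (hθ i hi), ← hgeom _ (hθ' i hi), ha i hi, hb i hi]
    congr 1 <;> refine Finset.sum_congr rfl fun j _ => pow_right_comm _ _ _
  rw [hsum] at hexp
  have hexp2 : ∑ i ∈ S, (if θ' i = 1 then (p : ℝ) else 0) = 0 := by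
    have h3 : ∑ i ∈ S, (if θ' i = 1 then (p : ℂ) else 0) = 0 := by
      rw [← neg_eq_zero, ← Finset.sum_neg_distrib]
      refine Eq.trans ?_ hexp.symm
      refine Finset.sum_congr rfl fun i hi => ?_
      rw [if_neg (h1 i hi), zero_sub]
    have := congrArg Complex.re h3
    rw [Complex.re_sum] at this
    simpa [apply_ite Complex.re] using this
  rw [Finset.sum_eq_zero_iff_of_nonneg (fun i _ => by positivity)] at hexp2
  intro i hi h
  have := hexp2 i hi
  rw [if_pos h] at this
  exact hp0 (by exact_mod_cast this)


/-- The modulus of the eigenvalue (before taking powers) of the Bass unit with `k = 2`. -/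
noncomputable def bassMu (z : ℂ) : ℝ := open Classical in if z = 1 then 1 else ‖1 + z‖

theorem norm_one_add_sq (z : ℂ) (hz : ‖z‖ = 1) : ‖1 + z‖ ^ 2 = 2 + 2 * z.re := by
  have h1 : ‖z‖ ^ 2 = 1 := by rw [hz]; norm_num
  rw [Complex.sq_norm, Complex.normSq_apply] at h1 ⊢
  simp only [Complex.add_re, Complex.one_re, Complex.add_im, Complex.one_im]
  linarith

theorem bassMu_sq (z : ℂ) (hz : ‖z‖ = 1) (h1 : z ≠ 1) : bassMu z ^ 2 = 2 + 2 * z.re := by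
  rw [bassMu, if_neg h1, norm_one_add_sq z hz]

theorem bassMu_nonneg (z : ℂ) : 0 ≤ bassMu z := by
  unfold bassMu
  split_ifs <;> positivity

theorem re_eq_one_of_norm {z : ℂ} (hz : ‖z‖ = 1) (h : z.re = 1) : z = 1 := by
  have h1 : ‖z‖ ^ 2 = 1 := by rw [hz]; norm_num
  rw [Complex.sq_norm, Complex.normSq_apply, h] at h1
  have h2 : z.im = 0 := by nlinarith
  exact Complex.ext (by simpa using h) (by simpa using h2)

theorem eq_one_of_coprime_pow {z : ℂ} {a b : ℕ} (hab : Nat.Coprime a b) (ha : z ^ a = 1)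
    (hb : z ^ b = 1) : z = 1 := by
  have h := Nat.dvd_gcd (orderOf_dvd_of_pow_eq_one ha) (orderOf_dvd_of_pow_eq_one hb)
  rw [hab.gcd_eq_one, Nat.dvd_one, orderOf_eq_one_iff] at h
  exact h

theorem eq_one_of_bassMu {z : ℂ} {d : ℕ} (hd : Nat.Coprime d 6) (hz : z ^ d = 1)
    (hn : ‖z‖ = 1) (h : bassMu z = 1) : z = 1 := by
  by_contra h1
  have h2 := bassMu_sq z hn h1
  rw [h] at h2
  have hre : z.re = -1 / 2 := by linarith
  have h3 : ‖z‖ ^ 2 = 1 := by rw [hn]; norm_num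
  rw [Complex.sq_norm, Complex.normSq_apply] at h3
  have h4 : z ^ 2 + z + 1 = 0 := by
    apply Complex.ext
    · simp [pow_two]
      rw [hre] at h3 ⊢
      nlinarith
    · simp [pow_two]
      rw [hre]
      ring
  have h5 : z ^ 3 = 1 := by
    have : z ^ 3 - 1 = (z - 1) * (z ^ 2 + z + 1) := by ring
    rw [h4, mul_zero] at this
    exact sub_eq_zero.1 this
  exact h1 (eq_one_of_coprime_pow (Nat.Coprime.coprime_mul_left_right (k := 2) hd) hz h5)

theorem bassMu_pos {z : ℂ} {d : ℕ} (hd : Nat.Coprime d 6) (hz : z ^ d = 1) : 0 < bassMu z := by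
  unfold bassMu
  split_ifs with h
  · exact one_pos
  · rw [norm_pos_iff]
    intro h0
    have h1 : z = -1 := by linear_combination h0
    have hodd : Nat.Coprime d 2 := Nat.Coprime.coprime_mul_right_right (k := 3) hd
    exact h (eq_one_of_coprime_pow hodd hz (by rw [h1]; norm_num))

/-- The extremal coefficient does not vanish. -/
theorem extremal_coeff_ne_zero {ι : Type*} [Fintype ι] (σ : ι → ι) (θ : ι → ℂ) (d p : ℕ)
    (hd0 : d ≠ 0) (hd : Nat.Coprime d 6) (hp : p.Prime) (hθ : ∀ i, θ i ^ d = 1)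
    (hη : ∀ i j, θ i ^ p = θ j ^ p)
    (htrans : ∀ S : Set ι, S.Nonempty → (∀ i ∈ S, σ i ∈ S) → ∀ i, i ∈ S)
    (hRe : ∃ i, (θ (σ i)).re ≠ (θ i).re) (ε M₀ : ℝ) (hε : ε = 1 ∨ ε = -1)
    (hext : ∀ i, ε * bassMu (θ i) ≤ ε * M₀) (hex : ∃ i, bassMu (θ i) = M₀) :
    (∑ i with bassMu (θ i) = M₀, (θ i - θ (σ i))) ≠ 0 := by
  classical
  intro hK
  have hn : ∀ i, ‖θ i‖ = 1 := fun i => Complex.norm_eq_one_of_pow_eq_one (hθ i) hd0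
  have hle : ∀ i, (θ i).re ≤ 1 := fun i => (Complex.re_le_norm _).trans (hn i).le
  set S := Finset.univ.filter fun i => bassMu (θ i) = M₀ with hS
  have hSmem : ∀ i, i ∈ S ↔ bassMu (θ i) = M₀ := fun i => by simp [hS]
  have hKre : ∑ i ∈ S, ((θ i).re - (θ (σ i)).re) = 0 := by
    have := congrArg Complex.re hK
    rw [Complex.re_sum] at this
    simpa using this
  -- it suffices to see that `σ` preserves real parts on `S` and maps `S` to itself
  have main : (∀ i ∈ S, (θ (σ i)).re = (θ i).re) → (∀ i ∈ S, σ i ∈ S) → False := by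
    intro h1 h2
    obtain ⟨i, hi⟩ := hRe
    obtain ⟨j, hj⟩ := hex
    exact hi (h1 i (htrans (↑S) ⟨j, (hSmem j).2 hj⟩ h2 i))
  by_cases hA : ∃ i ∈ S, θ i = 1
  · obtain ⟨i₀, hi₀, hi₁⟩ := hA
    have hM : M₀ = 1 := by
      rw [← (hSmem i₀).1 hi₀, hi₁, bassMu, if_pos rfl]
    have hall : ∀ i ∈ S, θ i = 1 := fun i hi =>
      eq_one_of_bassMu hd (hθ i) (hn i) (by rw [(hSmem i).1 hi, hM])
    have hz : ∀ i ∈ S, (θ i).re - (θ (σ i)).re = 0 := by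
      refine (Finset.sum_eq_zero_iff_of_nonneg fun i hi => ?_).1 hKre
      rw [hall i hi, Complex.one_re]
      linarith [hle (σ i)]
    refine main (fun i hi => by linarith [hz i hi]) fun i hi => ?_
    have h1 : θ (σ i) = 1 := by
      apply re_eq_one_of_norm (hn _)
      have := hz i hi
      rw [hall i hi, Complex.one_re] at this
      linarith
    rw [hSmem, h1, hM, bassMu, if_pos rfl]
  · push Not at hA
    have hB : ∀ i ∈ S, θ (σ i) ≠ 1 := by
      intro i hi h1
      have hp1 : ∀ j, θ j ^ p = 1 := fun j => by rw [hη j (σ i), h1, one_pow]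
      exact galois_argument S p hp θ (fun i => θ (σ i)) (fun i _ => hp1 i) (fun i _ => hp1 _)
        hA hK i hi h1
    have hmono : ∀ i ∈ S, ε * (θ (σ i)).re ≤ ε * (θ i).re := by
      intro i hi
      have h1 := hext (σ i)
      rw [← (hSmem i).1 hi] at h1
      have h2 := bassMu_sq _ (hn i) (hA i hi)
      have h3 := bassMu_sq _ (hn (σ i)) (hB i hi)
      have h4 := bassMu_nonneg (θ i)
      have h5 := bassMu_nonneg (θ (σ i))
      rcases hε with rfl | rfl <;> nlinarith
    have hz : ∀ i ∈ S, ε * (θ i).re - ε * (θ (σ i)).re = 0 := by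
      refine (Finset.sum_eq_zero_iff_of_nonneg fun i hi => ?_).1 ?_
      · linarith [hmono i hi]
      · simp only [← mul_sub]
        rw [← Finset.mul_sum, hKre, mul_zero]
    have hz' : ∀ i ∈ S, (θ (σ i)).re = (θ i).re := by
      intro i hi
      have := hz i hi
      rcases hε with rfl | rfl <;> linarith
    refine main hz' fun i hi => ?_
    have h2 := bassMu_sq _ (hn i) (hA i hi)
    have h3 := bassMu_sq _ (hn (σ i)) (hB i hi)
    rw [hz' i hi, ← h2] at h3
    rw [hSmem, ← (hSmem i).1 hi]
    exact (pow_left_inj₀ (bassMu_nonneg _) (bassMu_nonneg _) two_ne_zero).1 h3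


/-- `y` lies in an abelian subgroup normalized by `h`, and `y` does not normalize `⟨h⟩`. -/
def GoodPair {G : Type*} [Group G] (h y : G) : Prop :=
  ∃ A : Subgroup G, (∀ a ∈ A, ∀ b ∈ A, a * b = b * a) ∧ h ∈ Subgroup.normalizer (A : Set G) ∧
    y ∈ A ∧ y * h * y⁻¹ ∉ Subgroup.zpowers h

theorem goodPair_of_central {G : Type*} [Group G] [Finite G] {h y z : G}
    (hz : h * y = z * (y * h)) (hzh : Commute z h) (hzy : Commute z y)
    (hn : z ∉ Subgroup.zpowers h) : GoodPair h y := by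
  refine ⟨Subgroup.closure {y, z}, ?_, ?_, Subgroup.subset_closure (by simp), ?_⟩
  · have hc : IsMulCommutative (Subgroup.closure ({y, z} : Set G)) := by
      apply Subgroup.isMulCommutative_closure
      rintro a (rfl | rfl) b (rfl | rfl)
      · rfl
      · exact hzy.eq.symm
      · exact hzy.eq
      · rfl
    intro a ha b hb
    exact congrArg Subtype.val (hc.is_comm.comm ⟨a, ha⟩ ⟨b, hb⟩)
  · apply Subgroup.mem_normalizer_fintype
    intro n hn
    refine Subgroup.closure_induction (p := fun n _ => h * n * h⁻¹ ∈ Subgroup.closure {y, z})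
      ?_ ?_ ?_ ?_ hn
    · rintro a (rfl | rfl)
      · have : h * a * h⁻¹ = z * a := by rw [hz]; group
        rw [this]
        exact mul_mem (Subgroup.subset_closure (by simp)) (Subgroup.subset_closure (by simp))
      · have : h * a * h⁻¹ = a := by rw [← hzh.eq]; group
        rw [this]
        exact Subgroup.subset_closure (by simp)
    · simp
    · intro a b _ _ ha hb
      have : h * (a * b) * h⁻¹ = (h * a * h⁻¹) * (h * b * h⁻¹) := by group
      rw [this]
      exact mul_mem ha hb
    · intro a _ ha
      have : h * a⁻¹ * h⁻¹ = (h * a * h⁻¹)⁻¹ := by group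
      rw [this]
      exact inv_mem ha
  · intro hmem
    have h1 : y * h * y⁻¹ = z⁻¹ * h := by
      have : y * h = z⁻¹ * (h * y) := by rw [hz]; group
      rw [this]; group
    rw [h1] at hmem
    apply hn
    have h2 := mul_mem hmem (inv_mem (Subgroup.mem_zpowers h))
    rw [mul_inv_cancel_right] at h2
    simpa using inv_mem h2

theorem class_two_zpow {G : Type*} [Group G] {h y z : G}
    (hz : h * y = z * (y * h)) (hzh : Commute z h) (hzy : Commute z y) (m k : ℤ) :
    h ^ m * y ^ k = z ^ (m * k) * (y ^ k * h ^ m) := by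
  have h1 : SemiconjBy h y (z * y) := by
    change h * y = z * y * h
    rw [hz, mul_assoc]
  have h2 : SemiconjBy h (y ^ k) (z ^ k * y ^ k) := by
    have := h1.zpow_right k
    rwa [hzy.mul_zpow] at this
  have h3 : SemiconjBy (y ^ k) h ((z ^ k)⁻¹ * h) := by
    change y ^ k * h = (z ^ k)⁻¹ * h * y ^ k
    have := h2.eq
    rw [mul_assoc, this]; group
  have hc : Commute (z ^ k)⁻¹ h := (hzh.zpow_left k).inv_left
  have h4 : SemiconjBy (y ^ k) (h ^ m) (((z ^ k)⁻¹) ^ m * h ^ m) := by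
    have := h3.zpow_right m
    rwa [hc.mul_zpow] at this
  have h5 := h4.eq
  rw [h5, mul_comm m k, zpow_mul]
  group

theorem class_two_mul_pow {G : Type*} [Group G] {a b w : G}
    (hw : b * a = w * (a * b)) (hwa : Commute w a) (hwb : Commute w b) (n : ℕ) :
    (a * b) ^ n = w ^ (n.choose 2) * (a ^ n * b ^ n) := by
  have key := fun n : ℕ => class_two_zpow hw hwb hwa n 1
  induction n with
  | zero => simp
  | succ n ih =>
    rw [pow_succ, ih, Nat.choose_succ_succ, Nat.choose_one_right]
    have h1 := key n
    simp only [zpow_natCast, mul_one, zpow_one] at h1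
    have h2 : w ^ n * a ^ n = a ^ n * w ^ n := (hwa.pow_pow n n).eq
    calc w ^ n.choose 2 * (a ^ n * b ^ n) * (a * b)
        = w ^ n.choose 2 * (a ^ n * (b ^ n * a) * b) := by group
      _ = w ^ n.choose 2 * (a ^ n * (w ^ n * (a * b ^ n)) * b) := by rw [h1]
      _ = w ^ n.choose 2 * ((a ^ n * w ^ n) * (a * b ^ n) * b) := by group
      _ = w ^ n.choose 2 * ((w ^ n * a ^ n) * (a * b ^ n) * b) := by rw [h2]
      _ = w ^ (n + n.choose 2) * (a ^ (n + 1) * b ^ (n + 1)) := by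
          rw [add_comm n, pow_add, pow_succ, pow_succ]
          group

theorem prime_dvd_choose_two {p : ℕ} (hp : p.Prime) (hp2 : p ≠ 2) (t : ℕ) :
    p ∣ (p ^ t).choose 2 := by
  rcases Nat.eq_zero_or_pos t with rfl | ht
  · simp
  · have h1 : p ∣ (p ^ t).choose 2 * 2 := by
      rw [Nat.choose_two_right, Nat.div_mul_cancel (Nat.even_mul_pred_self _).two_dvd]
      exact Dvd.dvd.mul_right (dvd_pow_self p ht.ne') _
    exact (Nat.Coprime.dvd_of_dvd_mul_right
      ((Nat.coprime_primes hp Nat.prime_two).2 hp2) h1)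

theorem class_two_step {G : Type*} [Group G] [Finite G] {p : ℕ} (hp : p.Prime) (hp2 : p ≠ 2)
    {h y z : G} {r s : ℕ} (hr : orderOf h = p ^ r) (hs : orderOf y = p ^ s)
    (hle : orderOf y ≤ orderOf h)
    (hz : h * y = z * (y * h)) (hzh : Commute z h) (hzy : Commute z y) (hz1 : z ≠ 1)
    (hzp : z ^ p = 1) (h1 : z ∈ Subgroup.zpowers h) (h2 : z ∈ Subgroup.zpowers y) :
    ∃ y' z', orderOf y' < orderOf y ∧ (∃ k, orderOf y' = p ^ k) ∧ h * y' = z' * (y' * h) ∧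
      Commute z' h ∧ Commute z' y' ∧ z' ≠ 1 := by
  rw [← mem_powers_iff_mem_zpowers] at h1 h2
  obtain ⟨j, hj⟩ := h1
  obtain ⟨i, hi⟩ := h2
  simp only at hi hj
  have hsr : s ≤ r := by
    rw [hr, hs] at hle
    exact (Nat.pow_le_pow_iff_right hp.one_lt).1 hle
  obtain ⟨s, rfl⟩ : ∃ s', s = s' + 1 := by
    rcases s with _ | s
    · rw [pow_zero, orderOf_eq_one_iff] at hs
      rw [hs, one_pow] at hi
      exact absurd hi.symm hz1
    · exact ⟨s, rfl⟩
  obtain ⟨q, rfl⟩ : ∃ q, r = q + s + 1 := ⟨r - s - 1, by omega⟩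
  have hi' : p ^ s ∣ i := by
    have : y ^ (i * p) = 1 := by rw [pow_mul, hi, hzp]
    have := orderOf_dvd_of_pow_eq_one this
    rw [hs, pow_succ] at this
    exact Nat.dvd_of_mul_dvd_mul_right hp.pos this
  have hj' : p ^ (q + s) ∣ j := by
    have : h ^ (j * p) = 1 := by rw [pow_mul, hj, hzp]
    have := orderOf_dvd_of_pow_eq_one this
    rw [hr, pow_succ] at this
    exact Nat.dvd_of_mul_dvd_mul_right hp.pos this
  obtain ⟨i', rfl⟩ := hi'
  obtain ⟨j', rfl⟩ := hj'
  set e : ℤ := -((p ^ q * j' : ℕ) : ℤ) with he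
  have hw := class_two_zpow hz hzh hzy e i'
  have hwa : Commute (z ^ (e * (i' : ℤ))) (y ^ (i' : ℤ)) := hzy.zpow_zpow _ _
  have hwb : Commute (z ^ (e * (i' : ℤ))) (h ^ e) := hzh.zpow_zpow _ _
  have hpow := class_two_mul_pow hw hwa hwb (p ^ s)
  have e1 : (z ^ (e * (i' : ℤ))) ^ (p ^ s).choose 2 = 1 := by
    obtain ⟨c, hc⟩ := prime_dvd_choose_two hp hp2 s
    rw [hc, ← zpow_natCast, ← zpow_mul]
    have : e * (i' : ℤ) * ((p * c : ℕ) : ℤ) = (p : ℤ) * (e * i' * c) := by push_cast; ring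
    rw [this, zpow_mul, zpow_natCast, hzp, one_zpow]
  have e2 : (y ^ (i' : ℤ)) ^ (p ^ s) = z := by
    rw [zpow_natCast, ← pow_mul, mul_comm, hi]
  have e3 : (h ^ e) ^ (p ^ s) = z⁻¹ := by
    rw [he, zpow_neg, zpow_natCast, inv_pow, ← pow_mul, ← hj]
    congr 2
    ring
  rw [e1, e2, e3, one_mul, mul_inv_cancel] at hpow
  have hdvd := orderOf_dvd_of_pow_eq_one hpow
  refine ⟨y ^ (i' : ℤ) * h ^ e, z ^ i', ?_, ?_, ?_, ?_, ?_, ?_⟩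
  · rw [hs]
    exact lt_of_le_of_lt (Nat.le_of_dvd (pow_pos hp.pos _) hdvd)
      (Nat.pow_lt_pow_right hp.one_lt (Nat.lt_succ_self _))
  · obtain ⟨k, -, hk⟩ := (Nat.dvd_prime_pow hp).1 hdvd
    exact ⟨k, hk⟩
  · have h3 := class_two_zpow hz hzh hzy 1 i'
    rw [zpow_one, one_mul, zpow_natCast z] at h3
    rw [← mul_assoc, h3, mul_assoc, mul_assoc, mul_assoc]
    congr 2
    exact ((Commute.refl h).zpow_right e).eq
  · exact hzh.pow_left _
  · exact ((hzy.zpow_right _).mul_right (hzh.zpow_right _)).pow_left _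
  · intro h0
    have h4 := Nat.Coprime.symm ((Nat.coprime_or_dvd_of_prime hp i').resolve_right ?_)
    · have h5 := orderOf_dvd_of_pow_eq_one h0
      have h6 := orderOf_dvd_of_pow_eq_one hzp
      have h7 := Nat.dvd_gcd h5 h6
      rw [h4.gcd_eq_one, Nat.dvd_one, orderOf_eq_one_iff] at h7
      exact hz1 h7
    · rintro ⟨c, rfl⟩
      apply hz1
      rw [← hi, ← mul_assoc, ← pow_succ, ← hs, pow_mul, pow_orderOf_eq_one, one_pow]

theorem goodPair_of_class_two {G : Type*} [Group G] [Finite G] {p : ℕ} (hp : p.Prime)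
    (hp2 : p ≠ 2) : ∀ (n : ℕ) (h y z : G), orderOf h + orderOf y ≤ n →
    (∃ k, orderOf h = p ^ k) → (∃ k, orderOf y = p ^ k) →
    h * y = z * (y * h) → Commute z h → Commute z y → z ≠ 1 → ∃ h' y' : G, GoodPair h' y' := by
  intro n
  induction n with
  | zero =>
    intro h y z hn
    have := orderOf_pos h
    omega
  | succ n ih =>
    intro h y z hn hoh hoy hz hzh hzy hz1
    have hz' : y * h = z⁻¹ * (h * y) := by rw [hz]; group
    by_cases h1 : z ∈ Subgroup.zpowers h
    swap
    · exact ⟨h, y, goodPair_of_central hz hzh hzy h1⟩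
    by_cases h2 : z ∈ Subgroup.zpowers y
    swap
    · exact ⟨y, h, goodPair_of_central hz' hzy.inv_left hzh.inv_left (by simpa using h2)⟩
    obtain ⟨r, hr⟩ := hoh
    obtain ⟨s, hs⟩ := hoy
    by_cases hzp : z ^ p = 1
    swap
    · have h3 := class_two_zpow hz hzh hzy p 1
      rw [mul_one, zpow_one, zpow_natCast, zpow_natCast] at h3
      rcases r with _ | r
      · rw [pow_zero, orderOf_eq_one_iff] at hr
        rw [hr] at h1
        simp at h1
        exact absurd h1 hz1
      · have ho : orderOf (h ^ p) = p ^ r := by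
          rw [orderOf_pow_of_dvd hp.ne_zero (by rw [hr]; exact dvd_pow_self p (by omega)), hr,
            pow_succ, Nat.mul_div_cancel _ hp.pos]
        have hlt : p ^ r < p ^ (r + 1) := Nat.pow_lt_pow_right hp.one_lt (Nat.lt_succ_self _)
        refine ih (h ^ p) y (z ^ p) (by omega) ⟨r, ho⟩ ⟨s, hs⟩ h3 (hzh.pow_pow _ _)
          (hzy.pow_left _) hzp
    rcases le_total (orderOf y) (orderOf h) with hle | hle
    · obtain ⟨y', z', hlt, hk, a1, a2, a3, a4⟩ :=
        class_two_step hp hp2 hr hs hle hz hzh hzy hz1 hzp h1 h2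
      exact ih h y' z' (by omega) ⟨r, hr⟩ hk a1 a2 a3 a4
    · obtain ⟨h', z', hlt, hk, a1, a2, a3, a4⟩ :=
        class_two_step hp hp2 hs hr hle hz' hzy.inv_left hzh.inv_left (by simpa using hz1)
          (by rw [inv_pow, hzp, inv_one]) (by simpa using h2) (by simpa using h1)
      exact ih y h' z' (by omega) ⟨s, hs⟩ hk a1 a2 a3 a4

theorem exists_goodPair_of_sylow_nonabelian {G : Type*} [Group G] [Finite G] {p : ℕ}
    [hp : Fact p.Prime] (hp2 : p ≠ 2) (P : Subgroup G) (hP : IsPGroup p P)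
    (hna : ∃ a b : P, a * b ≠ b * a) : ∃ h y : G, GoodPair h y := by
  have hnt : Nontrivial (P ⧸ Subgroup.center P) := by
    rw [QuotientGroup.nontrivial_iff]
    intro htop
    obtain ⟨a, b, hab⟩ := hna
    have : b ∈ Subgroup.center P := by rw [htop]; trivial
    exact hab (Subgroup.mem_center_iff.1 this a)
  have hcn := (hP.to_quotient (Subgroup.center P)).center_nontrivial
  obtain ⟨⟨Y, hY⟩, hY1⟩ := exists_ne (1 : Subgroup.center (P ⧸ Subgroup.center P))
  obtain ⟨y, rfl⟩ := QuotientGroup.mk_surjective Y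
  have hyc : y ∉ Subgroup.center P := by
    intro hy
    apply hY1
    apply Subtype.ext
    exact (QuotientGroup.eq_one_iff y).2 hy
  rw [Subgroup.mem_center_iff] at hyc
  push Not at hyc
  obtain ⟨h, hh⟩ := hyc
  have hzc : h * y * h⁻¹ * y⁻¹ ∈ Subgroup.center P := by
    rw [← QuotientGroup.eq_one_iff]
    have := Subgroup.mem_center_iff.1 hY (h : P ⧸ Subgroup.center P)
    rw [QuotientGroup.mk_mul, QuotientGroup.mk_mul, QuotientGroup.mk_mul, QuotientGroup.mk_inv,
      QuotientGroup.mk_inv, this]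
    group
  obtain ⟨k1, hk1⟩ := IsPGroup.iff_orderOf.1 hP h
  obtain ⟨k2, hk2⟩ := IsPGroup.iff_orderOf.1 hP y
  rw [Subgroup.mem_center_iff] at hzc
  obtain ⟨h', y', hg⟩ : ∃ h' y' : P, GoodPair h' y' := by
    refine goodPair_of_class_two hp.out hp2 _ h y (h * y * h⁻¹ * y⁻¹) le_rfl ⟨k1, hk1⟩ ⟨k2, hk2⟩
      (by group) (hzc h).symm (hzc y).symm ?_
    intro h0
    apply hh
    calc h * y = (h * y * h⁻¹ * y⁻¹) * (y * h) := by group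
      _ = y * h := by rw [h0, one_mul]
  obtain ⟨A, hA, hn, hy, hnot⟩ := hg
  refine ⟨h', y', A.map P.subtype, ?_, ?_, ⟨y', hy, rfl⟩, ?_⟩
  · rintro _ ⟨a, ha, rfl⟩ _ ⟨b, hb, rfl⟩
    rw [← map_mul, ← map_mul, hA a ha b hb]
  · apply Subgroup.mem_normalizer_fintype
    rintro _ ⟨a, ha, rfl⟩
    exact ⟨h' * a * h'⁻¹, (Subgroup.mem_normalizer_iff.1 hn a).1 ha, by simp⟩
  · intro hmem
    apply hnot
    obtain ⟨k, hk⟩ := Subgroup.mem_zpowers_iff.1 hmem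
    refine Subgroup.mem_zpowers_iff.2 ⟨k, ?_⟩
    apply Subtype.ext
    simpa using hk

theorem exists_goodPair_of_sylow_abelian {G : Type*} [Group G] [Finite G] {p : ℕ}
    [hp : Fact p.Prime] (P : Sylow p G) (hab : ∀ a ∈ P, ∀ b ∈ P, a * b = b * a)
    (hN : ¬ Subgroup.normalizer (P : Set G) ≤ Subgroup.centralizer (P : Set G)) :
    ∃ h y : G, GoodPair h y := by
  obtain ⟨g, hgN, hgC⟩ := SetLike.not_le_iff_exists.1 hN
  obtain ⟨a, m, hm, hgo⟩ := Nat.exists_eq_pow_mul_and_not_dvd (orderOf_pos g).ne' p hp.out.ne_one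
  have hcop : Nat.Coprime (p ^ a) m := (hp.out.coprime_iff_not_dvd.2 hm).pow_left a
  have hgm : g ^ m ∈ P := by
    have hpg : IsPGroup p (Subgroup.zpowers (g ^ m)) := by
      apply IsPGroup.of_card (n := a)
      rw [Nat.card_zpowers, orderOf_pow_of_dvd (by rintro rfl; simp at hm)
        (by rw [hgo]; exact dvd_mul_left _ _), hgo, Nat.mul_div_cancel]
      exact Nat.pos_of_ne_zero (by rintro rfl; simp at hm)
    have h1 := hpg.inf_normalizer_sylow P
    have h2 : g ^ m ∈ Subgroup.zpowers (g ^ m) ⊓ Subgroup.normalizer (P : Set G) :=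
      ⟨Subgroup.mem_zpowers _, pow_mem hgN m⟩
    rw [h1] at h2
    exact h2.2
  have hgmC : g ^ m ∈ Subgroup.centralizer (P : Set G) := by
    rw [Subgroup.mem_centralizer_iff]
    intro b hb
    exact hab b hb _ hgm
  have hgpC : g ^ (p ^ a) ∉ Subgroup.centralizer (P : Set G) := by
    intro hc
    apply hgC
    have hbez := Nat.gcd_eq_gcd_ab (p ^ a) m
    rw [hcop.gcd_eq_one] at hbez
    have : g = (g ^ (p ^ a)) ^ (Nat.gcdA (p ^ a) m) * (g ^ m) ^ (Nat.gcdB (p ^ a) m) := by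
      rw [← zpow_natCast, ← zpow_natCast, ← zpow_mul, ← zpow_mul, ← zpow_add, ← hbez]
      simp
    rw [this]
    exact mul_mem (zpow_mem hc _) (zpow_mem hgmC _)
  set h := g ^ (p ^ a) with hh
  rw [Subgroup.mem_centralizer_iff] at hgpC
  push Not at hgpC
  obtain ⟨y, hy, hyh⟩ := hgpC
  have hhN : h ∈ Subgroup.normalizer (P : Set G) := pow_mem hgN _
  refine ⟨h, y, P, fun a ha b hb => hab a ha b hb, hhN, hy, ?_⟩
  intro hmem
  have hmem2 : y * h * y⁻¹ * h⁻¹ ∈ Subgroup.zpowers h :=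
    mul_mem hmem (inv_mem (Subgroup.mem_zpowers h))
  have hmem3 : y * h * y⁻¹ * h⁻¹ ∈ (P : Subgroup G) := by
    have h3 : h * y⁻¹ * h⁻¹ ∈ (P : Subgroup G) :=
      (Subgroup.mem_normalizer_iff.1 hhN y⁻¹).1 (inv_mem hy)
    have : y * h * y⁻¹ * h⁻¹ = y * (h * y⁻¹ * h⁻¹) := by group
    rw [this]
    exact mul_mem hy h3
  have ho1 : orderOf (y * h * y⁻¹ * h⁻¹) ∣ m := by
    refine (orderOf_dvd_of_mem_zpowers hmem2).trans ?_
    apply orderOf_dvd_of_pow_eq_one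
    rw [hh, ← pow_mul, ← hgo, pow_orderOf_eq_one]
  obtain ⟨k, hk⟩ := IsPGroup.iff_orderOf.1 P.2 ⟨_, hmem3⟩
  rw [Subgroup.orderOf_mk] at hk
  have h5 : orderOf (y * h * y⁻¹ * h⁻¹) = 1 := by
    have hc2 : Nat.Coprime (p ^ k) m := (hp.out.coprime_iff_not_dvd.2 hm).pow_left k
    rw [hk] at ho1 ⊢
    exact Nat.dvd_one.1 (hc2.gcd_eq_one ▸ Nat.dvd_gcd dvd_rfl ho1)
  rw [orderOf_eq_one_iff] at h5
  apply hyh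
  calc y * h = (y * h * y⁻¹ * h⁻¹) * (h * y) := by group
    _ = h * y := by rw [h5, one_mul]

theorem exists_goodPair {G : Type*} [Group G] [Finite G]
    (hnab : ∃ g₁ g₂ : G, g₁ * g₂ ≠ g₂ * g₁) (hodd : Odd (Nat.card G)) :
    ∃ h y : G, GoodPair h y := by
  by_contra hno
  obtain ⟨g₁, g₂, hg⟩ := hnab
  have hP : ∀ (p : ℕ) [Fact p.Prime] (P : Sylow p G), p ∣ Nat.card G →
      Subgroup.normalizer (P : Set G) ≤ Subgroup.centralizer (P : Set G) := by
    intro p hp P hpd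
    have hp2 : p ≠ 2 := by
      rintro rfl
      exact (Nat.not_even_iff_odd.2 hodd) (even_iff_two_dvd.2 hpd)
    by_contra hN
    by_cases hab : ∀ a ∈ P, ∀ b ∈ P, a * b = b * a
    · exact hno (exists_goodPair_of_sylow_abelian P hab hN)
    · push Not at hab
      obtain ⟨a, ha, b, hb, hne⟩ := hab
      exact hno (exists_goodPair_of_sylow_nonabelian hp2 P P.2
        ⟨⟨a, ha⟩, ⟨b, hb⟩, fun h => hne (congrArg Subtype.val h)⟩)
  set w := g₁ * g₂ * g₁⁻¹ * g₂⁻¹ with hw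
  have hw1 : w ≠ 1 := by
    intro h
    apply hg
    calc g₁ * g₂ = w * (g₂ * g₁) := by rw [hw]; group
      _ = g₂ * g₁ := by rw [h, one_mul]
  have ho : orderOf w ≠ 1 := by rwa [Ne, orderOf_eq_one_iff]
  obtain ⟨p, hp, hpd⟩ := Nat.exists_prime_and_dvd ho
  have hpf : Fact p.Prime := ⟨hp⟩
  have P : Sylow p G := default
  have hPC := hP p P (hpd.trans (orderOf_dvd_natCard w))
  have hker : w ∈ (MonoidHom.transferSylow P hPC).ker := by
    rw [MonoidHom.mem_ker, hw]
    have hcomm : ∀ a b : P, a * b = b * a := fun a b =>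
      Subtype.ext (hPC (Subgroup.le_normalizer b.2) a a.2)
    simp only [map_mul, map_inv]
    rw [hcomm (MonoidHom.transferSylow P hPC g₁)]
    group
  have h1 := MonoidHom.not_dvd_card_ker_transferSylow P hPC
  apply h1
  refine hpd.trans ?_
  have := orderOf_dvd_natCard (⟨w, hker⟩ : (MonoidHom.transferSylow P hPC).ker)
  rwa [Subgroup.orderOf_mk] at this


theorem exists_char {A : Type*} [CommGroup A] [Finite A] (K : Subgroup A) (c₁ c₂ : A)
    (h₁ : c₁ ∉ K) (h₂ : c₂ ∉ K) :
    ∃ χ : A →* ℂˣ, (∀ k ∈ K, χ k = 1) ∧ χ c₁ ≠ 1 ∧ χ c₂ ≠ 1 := by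
  have key : ∀ c : A, c ∉ K → ∃ χ : A →* ℂˣ, (∀ k ∈ K, χ k = 1) ∧ χ c ≠ 1 := by
    intro c hc
    have hc' : (c : A ⧸ K) ≠ 1 := fun h => hc ((QuotientGroup.eq_one_iff c).1 h)
    obtain ⟨φ, hφ⟩ := CommGroup.exists_apply_ne_one_of_hasEnoughRootsOfUnity (A ⧸ K) ℂ hc'
    refine ⟨φ.comp (QuotientGroup.mk' K), fun k hk => ?_, hφ⟩
    have : (k : A ⧸ K) = 1 := (QuotientGroup.eq_one_iff k).2 hk
    simp [this]
  obtain ⟨χ₁, a1, b1⟩ := key c₁ h₁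
  obtain ⟨χ₂, a2, b2⟩ := key c₂ h₂
  by_cases e1 : χ₁ c₂ = 1
  · by_cases e2 : χ₂ c₁ = 1
    · refine ⟨χ₁ * χ₂, fun k hk => by simp [a1 k hk, a2 k hk], ?_, ?_⟩
      · simpa [e2] using b1
      · simpa [e1] using b2
    · exact ⟨χ₂, a2, e2, b2⟩
  · exact ⟨χ₁, a1, b1, e1⟩

/-- Refinement of a good pair: `y` can be chosen such that a prime power of it normalizes `⟨h⟩`. -/
theorem GoodPair.refine {G : Type*} [Group G] [Finite G] {h y : G} (hg : GoodPair h y) :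
    ∃ (y' : G) (p : ℕ) (A : Subgroup G), p.Prime ∧ (∀ a ∈ A, ∀ b ∈ A, a * b = b * a) ∧
      h ∈ Subgroup.normalizer (A : Set G) ∧ y' ∈ A ∧ y' * h * y'⁻¹ ∉ Subgroup.zpowers h ∧
      y' ^ p * h * (y' ^ p)⁻¹ ∈ Subgroup.zpowers h := by
  obtain ⟨A, hA, hN, hy, hn⟩ := hg
  have key : ∀ n : ℕ, ∀ y ∈ A, orderOf y ≤ n → y * h * y⁻¹ ∉ Subgroup.zpowers h →
      ∃ (y' : G) (p : ℕ), p.Prime ∧ y' ∈ A ∧ y' * h * y'⁻¹ ∉ Subgroup.zpowers h ∧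
      y' ^ p * h * (y' ^ p)⁻¹ ∈ Subgroup.zpowers h := by
    intro n
    induction n with
    | zero =>
      intro y _ h0
      have := orderOf_pos y
      omega
    | succ n ih =>
      intro y hy hle hn
      have h1 : orderOf y ≠ 1 := by
        intro h1
        rw [orderOf_eq_one_iff] at h1
        apply hn
        simp [h1]
      obtain ⟨p, hp, hpd⟩ := Nat.exists_prime_and_dvd h1
      by_cases hc : y ^ p * h * (y ^ p)⁻¹ ∈ Subgroup.zpowers h
      · exact ⟨y, p, hp, hy, hn, hc⟩
      · refine ih (y ^ p) (pow_mem hy p) ?_ hc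
        rw [orderOf_pow_of_dvd hp.ne_zero hpd]
        have := Nat.div_lt_self (orderOf_pos y) hp.one_lt
        omega
  obtain ⟨y', p, a, b, c, e⟩ := key _ y hy le_rfl hn
  exact ⟨y', p, A, a, hA, hN, b, c, e⟩

/-- The character and the function `θ g = χ (g⁻¹ y g)` used in the main argument. -/
theorem exists_theta {G : Type*} [Group G] [Finite G] (hodd : Odd (Nat.card G)) {h y : G}
    {p : ℕ} {A : Subgroup G} (hA : ∀ a ∈ A, ∀ b ∈ A, a * b = b * a)
    (hN : h ∈ Subgroup.normalizer (A : Set G)) (hy : y ∈ A)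
    (hn : y * h * y⁻¹ ∉ Subgroup.zpowers h)
    (hp : y ^ p * h * (y ^ p)⁻¹ ∈ Subgroup.zpowers h) :
    ∃ χ : A →* ℂˣ, (∀ k : A, (k : G) ∈ Subgroup.zpowers h → χ k = 1) ∧
      ∃ θ : Subgroup.zpowers h → ℂ,
        (∀ (g : Subgroup.zpowers h) (hm : (g : G)⁻¹ * y * g ∈ A),
          θ g = (χ ⟨(g : G)⁻¹ * y * g, hm⟩ : ℂ)) ∧
        (∀ g : Subgroup.zpowers h, (g : G)⁻¹ * y * g ∈ A) ∧
        (∀ g, θ g ^ orderOf y = 1) ∧ (∀ g g', θ g ^ p = θ g' ^ p) ∧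
        (θ ⟨h⁻¹, inv_mem (Subgroup.mem_zpowers h)⟩).re ≠ (θ 1).re := by
  have hconj : ∀ g ∈ Subgroup.zpowers h, ∀ a ∈ A, g⁻¹ * a * g ∈ A := by
    intro g hg a ha
    have h1 : g ∈ Subgroup.normalizer (A : Set G) :=
      (Subgroup.zpowers_le.2 hN) hg
    have h2 := (Subgroup.mem_normalizer_iff.1 (inv_mem h1) a).1 ha
    simpa using h2
  let _ : CommGroup A := { (inferInstance : Group A) with
    mul_comm := fun a b => Subtype.ext (hA a a.2 b b.2) }
  have hhy : h * y * h⁻¹ ∈ A := by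
    simpa using hconj h⁻¹ (inv_mem (Subgroup.mem_zpowers h)) y hy
  have hc1 : h * y * h⁻¹ * y⁻¹ ∉ Subgroup.zpowers h := by
    intro hm
    apply hn
    have h1 := mul_mem (inv_mem hm) (Subgroup.mem_zpowers h)
    have : (h * y * h⁻¹ * y⁻¹)⁻¹ * h = y * h * y⁻¹ := by group
    rwa [this] at h1
  have hc2 : h * y * h⁻¹ * y ∉ Subgroup.zpowers h := by
    intro hm
    obtain ⟨k, hk⟩ := Subgroup.mem_zpowers_iff.1 hm
    have h1 : Commute h (h * y * h⁻¹ * y) := by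
      rw [← hk]; exact (Commute.refl h).zpow_right k
    have h2 : h * y * h⁻¹ * y = y * (h * y * h⁻¹) := hA _ hhy _ hy
    have h3 : h * (h * y * h⁻¹ * y) * h⁻¹ = h * y * h⁻¹ * y := by rw [h1.eq]; group
    have h4 : h ^ 2 * y * (h ^ 2)⁻¹ = y := by
      have e1 : h * (h * y * h⁻¹ * y) * h⁻¹ = (h ^ 2 * y * (h ^ 2)⁻¹) * (h * y * h⁻¹) := by
        rw [pow_two]; group
      rw [e1, h2] at h3
      exact mul_right_cancel h3
    have h5 : Commute (h ^ 2) y := by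
      change h ^ 2 * y = y * h ^ 2
      calc h ^ 2 * y = (h ^ 2 * y * (h ^ 2)⁻¹) * h ^ 2 := by group
        _ = y * h ^ 2 := by rw [h4]
    have hoh : Odd (orderOf h) := hodd.of_dvd_nat (orderOf_dvd_natCard h)
    obtain ⟨j, hj⟩ := hoh
    have h6 : Commute h y := by
      have : h = (h ^ 2) ^ (j + 1) := by
        rw [← pow_mul, show 2 * (j + 1) = orderOf h + 1 by omega, pow_succ, pow_orderOf_eq_one,
          one_mul]
      rw [this]
      exact h5.pow_left _
    apply hn
    rw [← h6.eq, mul_inv_cancel_right]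
    exact Subgroup.mem_zpowers h
  have hc1A : h * y * h⁻¹ * y⁻¹ ∈ A := mul_mem hhy (inv_mem hy)
  have hc2A : h * y * h⁻¹ * y ∈ A := mul_mem hhy hy
  obtain ⟨χ, hχ, hχ1, hχ2⟩ := exists_char ((Subgroup.zpowers h).subgroupOf A)
    ⟨_, hc1A⟩ ⟨_, hc2A⟩ (by rwa [Subgroup.mem_subgroupOf]) (by rwa [Subgroup.mem_subgroupOf])
  have hχ' : ∀ k : A, (k : G) ∈ Subgroup.zpowers h → χ k = 1 := fun k hk =>
    hχ k (by rwa [Subgroup.mem_subgroupOf])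
  have hmem : ∀ g : Subgroup.zpowers h, (g : G)⁻¹ * y * g ∈ A := fun g => hconj g g.2 y hy
  refine ⟨χ, hχ', fun g => (χ ⟨(g : G)⁻¹ * y * g, hmem g⟩ : ℂ), fun g hm => rfl, hmem, ?_, ?_, ?_⟩
  · intro g
    simp only
    rw [← Units.val_pow_eq_pow_val, ← map_pow]
    have : (⟨(g : G)⁻¹ * y * g, hmem g⟩ : A) ^ orderOf y = 1 := by
      apply Subtype.ext
      have e := conj_pow (i := orderOf y) (a := (g : G)⁻¹) (b := y)
      rw [inv_inv] at e
      simp [e, pow_orderOf_eq_one]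
    rw [this]; simp
  · have hp' : ∀ g ∈ Subgroup.zpowers h, y ^ p * g * (y ^ p)⁻¹ ∈ Subgroup.zpowers h := by
      intro g hg
      obtain ⟨k, rfl⟩ := Subgroup.mem_zpowers_iff.1 hg
      rw [← conj_zpow]
      exact zpow_mem hp k
    have hconst : ∀ g : Subgroup.zpowers h,
        (χ ⟨(g : G)⁻¹ * y * g, hmem g⟩) ^ p = χ ⟨y, hy⟩ ^ p := by
      intro g
      rw [← map_pow, ← map_pow, ← mul_inv_eq_one, ← map_inv, ← map_mul]
      apply hχ'
      have e := conj_pow (i := p) (a := (g : G)⁻¹) (b := y)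
      rw [inv_inv] at e
      have e2 : (((⟨(g : G)⁻¹ * y * g, hmem g⟩ : A) ^ p * ((⟨y, hy⟩ : A) ^ p)⁻¹ : A) : G)
          = (g : G)⁻¹ * (y ^ p * g * (y ^ p)⁻¹) := by
        change ((g : G)⁻¹ * y * g) ^ p * (y ^ p)⁻¹ = _
        rw [e]
        simp only [mul_assoc]
      rw [e2]
      exact mul_mem (inv_mem g.2) (hp' g g.2)
    intro g g'
    simp only
    rw [← Units.val_pow_eq_pow_val, ← Units.val_pow_eq_pow_val, hconst g, hconst g']
  · intro hre
    simp only at hre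
    set a : A := ⟨y, hy⟩ with ha
    set b : A := ⟨h * y * h⁻¹, hhy⟩ with hb
    have e1 : (⟨((1 : Subgroup.zpowers h) : G)⁻¹ * y * (1 : Subgroup.zpowers h), hmem 1⟩ : A) = a := by
      apply Subtype.ext; simp [ha]
    have e2 : ∀ hm, (⟨(h⁻¹)⁻¹ * y * h⁻¹, hm⟩ : A) = b := by
      intro hm
      apply Subtype.ext; simp [hb]
    rw [e1, e2] at hre
    have hnorm : ∀ x : A, ‖(χ x : ℂ)‖ = 1 := by
      intro x
      have hx : ((χ x : ℂˣ) : ℂ) ^ orderOf x = 1 := by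
        rw [← Units.val_pow_eq_pow_val, ← map_pow, pow_orderOf_eq_one]; simp
      exact Complex.norm_eq_one_of_pow_eq_one hx (orderOf_pos x).ne'
    have hsq : ∀ x : A, (χ x : ℂ).re ^ 2 + (χ x : ℂ).im ^ 2 = 1 := by
      intro x
      have := Complex.sq_norm (χ x : ℂ)
      rw [hnorm, Complex.normSq_apply] at this
      nlinarith
    have him : ((χ b : ℂ).im - (χ a : ℂ).im) * ((χ b : ℂ).im + (χ a : ℂ).im) = 0 := by
      have := hsq a
      have := hsq b
      rw [hre] at this
      nlinarith
    rcases mul_eq_zero.1 him with h0 | h0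
    · apply hχ1
      have : χ b = χ a := Units.ext (Complex.ext hre (by linarith))
      have e3 : (⟨h * y * h⁻¹ * y⁻¹, hc1A⟩ : A) = b * a⁻¹ := Subtype.ext rfl
      rw [e3, map_mul, map_inv, this, mul_inv_cancel]
    · apply hχ2
      have e3 : (⟨h * y * h⁻¹ * y, hc2A⟩ : A) = b * a := Subtype.ext rfl
      rw [e3, map_mul]
      apply Units.ext
      have := hsq a
      apply Complex.ext
      · simp [hre]
        nlinarith
      · simp [hre]
        have : (χ b : ℂ).im = - (χ a : ℂ).im := by linarith
        rw [this]; ring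

theorem bass_inverse_aux {R : Type*} [CommRing R] (x : R) (d k m : ℕ) (hd0 : 0 < d)
    (hx : x ^ d = 1) (hk : 2 * k = d + 1) (c c' : ℤ) (hc : (d : ℤ) * c = 1 - 2 ^ m)
    (hc' : (d : ℤ) * c' = 1 - (k : ℤ) ^ m) :
    ((1 + x) ^ m + c • ∑ i ∈ Finset.range d, x ^ i) *
      ((∑ i ∈ Finset.range k, (x ^ 2) ^ i) ^ m + c' • ∑ i ∈ Finset.range d, x ^ i) = 1 := by
  set Y := ∑ i ∈ Finset.range d, x ^ i with hY
  set S := ∑ i ∈ Finset.range k, (x ^ 2) ^ i with hS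
  have hYx : Y * x = Y := by
    have h1 : ∑ i ∈ Finset.range (d + 1), x ^ i = Y + 1 := by
      rw [Finset.sum_range_succ, hx]
    rw [Finset.sum_range_succ', pow_zero] at h1
    have h2 := add_right_cancel h1
    calc Y * x = ∑ i ∈ Finset.range d, x ^ (i + 1) := by
          rw [hY, Finset.sum_mul]; simp only [pow_succ]
      _ = Y := h2
  have hYpow : ∀ i, Y * x ^ i = Y := by
    intro i
    induction i with
    | zero => simp
    | succ i ih => rw [pow_succ, ← mul_assoc, ih, hYx]
  have hY1 : Y * (1 + x) = 2 * Y := by rw [mul_add, hYx]; ring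
  have hYY : Y * Y = d * Y := by
    nth_rewrite 2 [hY]
    rw [Finset.mul_sum]
    simp [hYpow]
  have hYS : Y * S = k * Y := by
    rw [hS, Finset.mul_sum]
    simp [← pow_mul, hYpow]
  have h1S : (1 + x) * S = 1 + Y := by
    have : ∀ n : ℕ, (1 + x) * ∑ i ∈ Finset.range n, (x ^ 2) ^ i
        = ∑ i ∈ Finset.range (2 * n), x ^ i := by
      intro n
      induction n with
      | zero => simp
      | succ n ih =>
        rw [Finset.sum_range_succ, mul_add, ih, show 2 * (n + 1) = 2 * n + 1 + 1 by ring,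
          Finset.sum_range_succ, Finset.sum_range_succ]
        ring
    rw [hS, this, hk, Finset.sum_range_succ, hx, add_comm]
  have hYm : ∀ (z : R) (a : R), Y * z = a * Y → ∀ m : ℕ, Y * z ^ m = a ^ m * Y := by
    intro z a hz m
    induction m with
    | zero => simp
    | succ m ih => rw [pow_succ, ← mul_assoc, ih, mul_assoc, hz]; ring
  have hpow : ∀ m : ℕ, ∃ e : ℤ, (d : ℤ) * e = ((d : ℤ) + 1) ^ m - 1 ∧ (1 + Y) ^ m = 1 + e * Y := by
    intro m
    induction m with
    | zero => exact ⟨0, by simp, by simp⟩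
    | succ m ih =>
      obtain ⟨e, h1, h2⟩ := ih
      refine ⟨1 + e + e * d, ?_, ?_⟩
      · rw [pow_succ]
        linear_combination ((d : ℤ) + 1) * h1
      · rw [pow_succ, h2]
        push_cast
        linear_combination (e : R) * hYY
  obtain ⟨e, he, hpe⟩ := hpow m
  have h2m := hYm _ 2 hY1 m
  have hkm := hYm _ k hYS m
  have hz : e + c * (k : ℤ) ^ m + c' * 2 ^ m + c * c' * d = 0 := by
    have hd' : (d : ℤ) ≠ 0 := by exact_mod_cast hd0.ne'
    apply mul_left_cancel₀ hd'
    have h3 : ((d : ℤ) + 1) ^ m = 2 ^ m * (k : ℤ) ^ m := by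
      rw [← mul_pow]; congr 1; exact_mod_cast hk.symm
    rw [h3] at he
    linear_combination he + ((k : ℤ) ^ m + (d : ℤ) * c') * hc + (1 : ℤ) * hc'
  have hz' : ((e + c * (k : ℤ) ^ m + c' * 2 ^ m + c * c' * d : ℤ) : R) = 0 := by
    rw [hz]; simp
  push_cast at hz'
  simp only [zsmul_eq_mul]
  have hprod : (1 + x) ^ m * S ^ m = 1 + e * Y := by rw [← mul_pow, h1S, hpe]
  linear_combination hprod + (c : R) * hkm + (c' : R) * h2m + (c : R) * c' * hYY + Y * hz'

theorem bass_isUnit {G : Type*} [Group G] [Finite G] (y : G) (m : ℕ) (hodd : Odd (orderOf y))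
    (hm : (orderOf y).totient ∣ m) :
    ∃ u : (MonoidAlgebra ℤ G)ˣ, (u : MonoidAlgebra ℤ G) = bassCyclic y 2 m := by
  set d := orderOf y with hd
  have hd0 : 0 < d := orderOf_pos y
  obtain ⟨j, hj⟩ := hodd
  set X : MonoidAlgebra ℤ G := MonoidAlgebra.of ℤ G y with hX
  have hXd : X ^ d = 1 := by rw [hX, ← map_pow, hd, pow_orderOf_eq_one, map_one]
  have euler : ∀ k : ℕ, Nat.Coprime k d → (d : ℤ) ∣ 1 - (k : ℤ) ^ m := by
    intro k hk
    obtain ⟨q, rfl⟩ := hm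
    have h1 := (Nat.ModEq.pow_totient hk).pow q
    rw [one_pow, ← pow_mul] at h1
    have h2 := h1.dvd
    push_cast at h2
    exact h2
  have c2 : Nat.Coprime 2 d := by
    rw [hj]; simp
  have ck : Nat.Coprime (j + 1) d := by
    rw [hj, show 2 * j + 1 = j + (j + 1) by ring]; simp
  let S := Algebra.adjoin ℤ ({X} : Set (MonoidAlgebra ℤ G))
  have hcomm : IsMulCommutative S := Algebra.isMulCommutative_adjoin ℤ (by
    intro a ha b hb
    rw [Set.mem_singleton_iff] at ha hb
    rw [ha, hb])
  let _ : CommRing S := { (inferInstance : Ring S) with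
    mul_comm := hcomm.is_comm.comm }
  let x : S := ⟨X, Algebra.subset_adjoin (by simp)⟩
  have hx : x ^ d = 1 := Subtype.ext hXd
  have key := bass_inverse_aux x d (j + 1) m hd0 hx (by omega) ((1 - 2 ^ m) / d)
    ((1 - ((j + 1 : ℕ) : ℤ) ^ m) / d) (Int.mul_ediv_cancel' (euler 2 c2))
    (Int.mul_ediv_cancel' (euler _ ck))
  have hv : (((1 + x) ^ m + ((1 - 2 ^ m) / (d : ℤ)) • ∑ i ∈ Finset.range d, x ^ i : S) :
      MonoidAlgebra ℤ G) = bassCyclic y 2 m := by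
    have hval : ∀ i, ((x ^ i : S) : MonoidAlgebra ℤ G) = X ^ i := fun i => rfl
    simp [bassCyclic, Finset.sum_range_succ, hval, x, ← hX, ← hd]
  obtain ⟨w, hw⟩ := IsUnit.of_mul_eq_one _ key
  refine ⟨Units.map S.subtype.toMonoidHom w, ?_⟩
  rw [← hv, ← hw]
  rfl

/-- Left translation of functions on `G`. -/
def translateHom (G : Type*) [Group G] : G →* Module.End ℂ (G → ℂ) where
  toFun g :=
    { toFun := fun f t => f (g⁻¹ * t)
      map_add' := fun _ _ => rfl
      map_smul' := fun _ _ => rfl }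
  map_one' := by ext; simp
  map_mul' a b := by
    apply LinearMap.ext
    intro f
    funext t
    simp [mul_assoc]

/-- The left regular representation of `ℤG` on the functions on `G`. -/
noncomputable def regRep (G : Type*) [Group G] :
    MonoidAlgebra ℤ G →ₐ[ℤ] Module.End ℂ (G → ℂ) :=
  MonoidAlgebra.lift ℤ (Module.End ℂ (G → ℂ)) G (translateHom G)

theorem regRep_of {G : Type*} [Group G] (g : G) (f : G → ℂ) (t : G) :
    regRep G (MonoidAlgebra.of ℤ G g) f t = f (g⁻¹ * t) := by
  rw [regRep, MonoidAlgebra.lift_of]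
  rfl

/-- The functions which transform under right translation by `A` through `χ⁻¹`. -/
def covFun {G : Type*} [Group G] {A : Subgroup G} (χ : A →* ℂˣ) : Submodule ℂ (G → ℂ) where
  carrier := {f | ∀ (t : G) (b : A), f (t * b) = ((χ b)⁻¹ : ℂˣ) * f t}
  add_mem' := by
    intro f f' hf hf' t b
    simp only [Pi.add_apply, hf t b, hf' t b, mul_add]
  zero_mem' := by intro t b; simp
  smul_mem' := by
    intro c f hf t b
    simp only [Pi.smul_apply, hf t b, smul_eq_mul]
    ring

theorem mem_covFun {G : Type*} [Group G] {A : Subgroup G} {χ : A →* ℂˣ} {f : G → ℂ} :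
    f ∈ covFun χ ↔ ∀ (t : G) (b : A), f (t * b) = ((χ b)⁻¹ : ℂˣ) * f t := Iff.rfl

theorem regRep_mem {G : Type*} [Group G] {A : Subgroup G} {χ : A →* ℂˣ} {f : G → ℂ}
    (hf : f ∈ covFun χ) (a : MonoidAlgebra ℤ G) : regRep G a f ∈ covFun χ := by
  induction a using MonoidAlgebra.induction_on with
  | of g =>
    intro t b
    rw [regRep_of, regRep_of, ← mul_assoc]
    exact hf _ b
  | add a b ha hb =>
    rw [map_add, LinearMap.add_apply]
    exact add_mem ha hb
  | smul r a ha =>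
    rw [map_zsmul, LinearMap.smul_apply]
    exact zsmul_mem ha r

theorem regRep_y {G : Type*} [Group G] {A : Subgroup G} {χ : A →* ℂˣ} {h y : G}
    {θ : Subgroup.zpowers h → ℂ} (hmem : ∀ g : Subgroup.zpowers h, (g : G)⁻¹ * y * g ∈ A)
    (hθ : ∀ (g : Subgroup.zpowers h) (hm : (g : G)⁻¹ * y * g ∈ A),
          θ g = (χ ⟨(g : G)⁻¹ * y * g, hm⟩ : ℂ))
    {f : G → ℂ} (hf : f ∈ covFun χ) (g : Subgroup.zpowers h) :
    regRep G (MonoidAlgebra.of ℤ G y) f g = θ g * f g := by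
  rw [regRep_of, hθ g (hmem g)]
  have h1 := hf (y⁻¹ * g) ⟨_, hmem g⟩
  have h2 : y⁻¹ * (g : G) * ((g : G)⁻¹ * y * g) = g := by group
  rw [h2] at h1
  rw [h1, ← mul_assoc, ← Units.val_mul, mul_inv_cancel, Units.val_one, one_mul]

theorem regRep_pow {G : Type*} [Group G] {A : Subgroup G} {χ : A →* ℂˣ}
    (a : MonoidAlgebra ℤ G) (t : G) (l : ℂ)
    (ha : ∀ f ∈ covFun χ, regRep G a f t = l * f t) (n : ℕ) :
    ∀ f ∈ covFun χ, regRep G (a ^ n) f t = l ^ n * f t := by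
  induction n with
  | zero => intro f _; simp
  | succ n ih =>
    intro f hf
    rw [pow_succ, map_mul, Module.End.mul_apply, ih _ (regRep_mem hf a), ha f hf, pow_succ]
    ring

theorem regRep_unit_zpow {G : Type*} [Group G] {A : Subgroup G} {χ : A →* ℂˣ}
    (u : (MonoidAlgebra ℤ G)ˣ) (t : G) (l : ℂ) (hl : l ≠ 0)
    (ha : ∀ f ∈ covFun χ, regRep G (u : MonoidAlgebra ℤ G) f t = l * f t) (n : ℤ) :
    ∀ f ∈ covFun χ, regRep G ((u ^ n : (MonoidAlgebra ℤ G)ˣ) : MonoidAlgebra ℤ G) f t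
      = l ^ n * f t := by
  have hinv : ∀ f ∈ covFun χ, regRep G ((u⁻¹ : (MonoidAlgebra ℤ G)ˣ) : MonoidAlgebra ℤ G) f t
      = l⁻¹ * f t := by
    intro f hf
    have h1 := ha _ (regRep_mem hf ((u⁻¹ : (MonoidAlgebra ℤ G)ˣ) : MonoidAlgebra ℤ G))
    rw [← Module.End.mul_apply, ← map_mul, Units.mul_inv, map_one, Module.End.one_apply] at h1
    rw [h1, inv_mul_cancel_left₀ hl]
  intro f hf
  rcases n with n | n
  · rw [Int.ofNat_eq_natCast, zpow_natCast, zpow_natCast, Units.val_pow_eq_pow_val]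
    exact regRep_pow _ t l ha n f hf
  · rw [zpow_negSucc, zpow_negSucc, ← inv_pow, ← inv_pow, Units.val_pow_eq_pow_val]
    exact regRep_pow _ t _ hinv (n + 1) f hf

theorem regRep_bass {G : Type*} [Group G] {A : Subgroup G} {χ : A →* ℂˣ}
    (y : G) (m : ℕ) (t : G) (l : ℂ)
    (ha : ∀ f ∈ covFun χ, regRep G (MonoidAlgebra.of ℤ G y) f t = l * f t)
    {f : G → ℂ} (hf : f ∈ covFun χ) :
    regRep G (bassCyclic y 2 m) f t = ((1 + l) ^ m + (((1 - 2 ^ m) / (orderOf y : ℤ) : ℤ) : ℂ) *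
      ∑ i ∈ Finset.range (orderOf y), l ^ i) * f t := by
  have h1 : ∀ f ∈ covFun χ, regRep G (∑ i ∈ Finset.range 2, (MonoidAlgebra.of ℤ G y) ^ i) f t
      = (1 + l) * f t := by
    intro f hf
    rw [Finset.sum_range_succ, Finset.sum_range_one, pow_zero, pow_one, map_add, map_one,
      LinearMap.add_apply, Pi.add_apply, Module.End.one_apply, ha f hf]
    ring
  rw [bassCyclic, map_add, LinearMap.add_apply, Pi.add_apply, regRep_pow _ t _ h1 m f hf,
    map_zsmul, LinearMap.smul_apply, Pi.smul_apply, map_sum, LinearMap.sum_apply,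
    Finset.sum_apply, Finset.sum_congr rfl (fun i _ => regRep_pow _ t l ha i f hf),
    ← Finset.sum_mul, zsmul_eq_mul]
  push_cast
  ring

theorem bass_eigenvalue {d m c : ℕ} {z : ℂ} (hd0 : 0 < d)
    (hz : z ^ d = 1) (hm : m = 2 * d * c) (hdv : (d : ℤ) ∣ 1 - 2 ^ m) :
    (1 + z) ^ m + (((1 - 2 ^ m) / (d : ℤ) : ℤ) : ℂ) * ∑ i ∈ Finset.range d, z ^ i
      = ((bassMu z ^ m : ℝ) : ℂ) := by
  by_cases h1 : z = 1
  · subst h1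
    have h2 : (((1 - 2 ^ m) / (d : ℤ) : ℤ) : ℂ) * d = 1 - 2 ^ m := by
      have := Int.ediv_mul_cancel hdv
      exact_mod_cast this
    simp [bassMu, h2]
    norm_num
  · have h3 : ∑ i ∈ Finset.range d, z ^ i = 0 := by
      have := geom_sum_mul z d
      rw [hz, sub_self] at this
      exact (mul_eq_zero.1 this).resolve_right (sub_ne_zero.2 h1)
    have hn : ‖z‖ = 1 := Complex.norm_eq_one_of_pow_eq_one hz hd0.ne'
    have hzz : z * (starRingEnd ℂ) z = 1 := by
      rw [Complex.mul_conj, Complex.normSq_eq_norm_sq, hn]; simp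
    have h4 : (1 + z) ^ 2 = z * ((‖1 + z‖ ^ 2 : ℝ) : ℂ) := by
      rw [← Complex.normSq_eq_norm_sq, ← Complex.mul_conj]
      simp only [map_add, map_one]
      linear_combination -(1 + z) * hzz
    rw [h3, mul_zero, add_zero, hm, mul_assoc, pow_mul, h4, pow_mul, mul_pow, hz, one_mul, bassMu,
      if_neg h1]
    push_cast
    rw [← pow_mul, ← pow_mul]

theorem sum_range_zpowers {G : Type*} [Group G] [Finite G] (h : G)
    [Fintype (Subgroup.zpowers h)] (F : G → ℂ) :
    ∑ i ∈ Finset.range (orderOf h), F (h ^ i) = ∑ g : Subgroup.zpowers h, F g := by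
  rw [Finset.sum_range]
  exact Fintype.sum_equiv (finEquivZPowers (isOfFinOrder_of_finite h)) _ _ (fun i => rfl)

theorem regRep_hat {G : Type*} [Group G] [Finite G] (h : G)
    [Fintype (Subgroup.zpowers h)] (f : G → ℂ) (g : Subgroup.zpowers h) :
    regRep G (hat h) f g = ∑ g' : Subgroup.zpowers h, f g' := by
  rw [hat, map_sum, LinearMap.sum_apply, Finset.sum_apply]
  simp only [← map_pow, regRep_of]
  rw [sum_range_zpowers h (fun x => f (x⁻¹ * g))]
  exact Fintype.sum_equiv ((Equiv.inv _).trans (Equiv.mulRight g)) _ _ (fun i => by simp)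

theorem regRep_bicyclic {G : Type*} [Group G] [Finite G] {A : Subgroup G} {χ : A →* ℂˣ} {h y : G}
    [Fintype (Subgroup.zpowers h)] {θ : Subgroup.zpowers h → ℂ}
    (hy : ∀ f ∈ covFun χ, ∀ g : Subgroup.zpowers h,
      regRep G (MonoidAlgebra.of ℤ G y) f g = θ g * f g)
    {f : G → ℂ} (hf : f ∈ covFun χ) (s : ℂ) (a : MonoidAlgebra ℤ G)
    (ha : ∀ g : Subgroup.zpowers h, regRep G a f g = s) (g : Subgroup.zpowers h) :
    regRep G ((1 - MonoidAlgebra.of ℤ G h) * MonoidAlgebra.of ℤ G y * a) f g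
      = s * (θ g - θ (⟨h⁻¹, inv_mem (Subgroup.mem_zpowers h)⟩ * g)) := by
  have h1 : ∀ g : Subgroup.zpowers h,
      regRep G (MonoidAlgebra.of ℤ G y * a) f g = θ g * s := by
    intro g
    rw [map_mul, Module.End.mul_apply, hy _ (regRep_mem hf a), ha]
  rw [mul_assoc, sub_mul, one_mul, map_sub, LinearMap.sub_apply, Pi.sub_apply, h1, map_mul,
    Module.End.mul_apply, regRep_of]
  have h2 := h1 (⟨h⁻¹, inv_mem (Subgroup.mem_zpowers h)⟩ * g)
  simp only [Subgroup.coe_mul] at h2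
  rw [h2]
  ring

theorem hat_mul_one_sub {G : Type*} [Group G] (h : G) :
    hat h * (1 - MonoidAlgebra.of ℤ G h) = 0 := by
  have := geom_sum_mul (MonoidAlgebra.of ℤ G h) (orderOf h)
  rw [← map_pow, pow_orderOf_eq_one, map_one, sub_self] at this
  rw [hat, ← neg_sub, mul_neg, this, neg_zero]

theorem exists_unipotent_unit {R : Type*} [Ring R] (a : R) (ha : a * a = 0) :
    ∃ β : Rˣ, (β : R) = 1 + a ∧ ∀ n : ℤ, ((β ^ n : Rˣ) : R) = 1 + n • a := by
  let β : Rˣ := ⟨1 + a, 1 - a, by noncomm_ring; simp [ha, pow_two], by noncomm_ring; simp [ha, pow_two]⟩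
  have hp : ∀ (b : R) (_ : b * b = 0) (n : ℕ), (1 + b) ^ n = 1 + n • b := by
    intro b hb n
    induction n with
    | zero => simp
    | succ n ih =>
      rw [pow_succ, ih, mul_add, mul_one, add_mul, one_mul, smul_mul_assoc, hb, smul_zero,
        add_zero, succ_nsmul, add_assoc]
  refine ⟨β, rfl, ?_⟩
  intro n
  rcases n with n | n
  · rw [Int.ofNat_eq_natCast, zpow_natCast, Units.val_pow_eq_pow_val]
    change (1 + a) ^ n = _
    rw [hp a ha, natCast_zsmul]
  · rw [zpow_negSucc, ← inv_pow, Units.val_pow_eq_pow_val]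
    change (1 - a) ^ (n + 1) = _
    rw [sub_eq_add_neg, hp (-a) (by simp [ha]), Int.negSucc_eq, neg_smul, smul_neg]
    norm_cast

/-- A covariant function equal to `1` on `⟨h⟩`. -/
theorem exists_w0 {G : Type*} [Group G] {A : Subgroup G} (χ : A →* ℂˣ) (h : G)
    (hχ : ∀ k : A, (k : G) ∈ Subgroup.zpowers h → χ k = 1) :
    ∃ w ∈ covFun χ, ∀ g : Subgroup.zpowers h, w g = 1 := by
  classical
  let P : G → Prop := fun t => ∃ (g : Subgroup.zpowers h) (b : A), t = g * b
  let w : G → ℂ := fun t => if ht : P t then (((χ ht.choose_spec.choose)⁻¹ : ℂˣ) : ℂ) else 0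
  have hw : ∀ (g : Subgroup.zpowers h) (b : A), w (g * b) = ((χ b)⁻¹ : ℂˣ) := by
    intro g b
    have hP : P (g * b) := ⟨g, b, rfl⟩
    simp only [w, dif_pos hP]
    have hs := hP.choose_spec.choose_spec
    set g' := hP.choose
    set b' := hP.choose_spec.choose
    have h1 : χ (b' * b⁻¹) = 1 := by
      apply hχ
      have : ((b' * b⁻¹ : A) : G) = (g' : G)⁻¹ * g := by
        push_cast
        rw [mul_inv_eq_iff_eq_mul, mul_assoc, hs]
        exact (inv_mul_cancel_left (g' : G) b').symm
      rw [this]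
      exact mul_mem (inv_mem g'.2) g.2
    rw [map_mul, map_inv, mul_inv_eq_one] at h1
    rw [h1]
  refine ⟨w, ?_, ?_⟩
  · rw [mem_covFun]
    intro t b
    by_cases hP : P t
    · obtain ⟨g, b', rfl⟩ := hP
      have := hw g (b' * b)
      rw [Subgroup.coe_mul, ← mul_assoc] at this
      rw [this, hw, map_mul, mul_inv, mul_comm, Units.val_mul]
    · have hP' : ¬ P (t * b) := by
        rintro ⟨g, b', hb⟩
        apply hP
        refine ⟨g, b' * b⁻¹, ?_⟩
        rw [Subgroup.coe_mul, ← mul_assoc, ← hb]; simp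
      simp only [w, dif_neg hP, dif_neg hP', mul_zero]
  · intro g
    have := hw g 1
    simpa using this

theorem zpow_le_extremal {r M m : ℝ} (hm : 0 < m) (h1 : m ≤ r) (h2 : r ≤ M) (n : ℤ) :
    r ^ n ≤ if 0 ≤ n then M ^ n else m ^ n := by
  have hr : 0 < r := hm.trans_le h1
  split_ifs with hn
  · exact zpow_le_zpow_left₀ hn hr.le h2
  · obtain ⟨k, rfl⟩ : ∃ k : ℕ, n = -(k : ℤ) := ⟨n.natAbs, by omega⟩
    rw [zpow_neg, zpow_neg, zpow_natCast, zpow_natCast]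
    exact inv_anti₀ (pow_pos hm k) (pow_le_pow_left₀ hm.le h1 k)

theorem free_pair_of_theta {G : Type*} [Group G] [Finite G] (hcop : Nat.Coprime (Nat.card G) 6)
    {h y : G} {p : ℕ} (hp : p.Prime) {A : Subgroup G} (χ : A →* ℂˣ)
    (hχ : ∀ k : A, (k : G) ∈ Subgroup.zpowers h → χ k = 1)
    (θ : Subgroup.zpowers h → ℂ)
    (hθ : ∀ (g : Subgroup.zpowers h) (hm : (g : G)⁻¹ * y * g ∈ A),
          θ g = (χ ⟨(g : G)⁻¹ * y * g, hm⟩ : ℂ))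
    (hmem : ∀ g : Subgroup.zpowers h, (g : G)⁻¹ * y * g ∈ A)
    (hθd : ∀ g, θ g ^ orderOf y = 1) (hθp : ∀ g g', θ g ^ p = θ g' ^ p)
    (hre : (θ ⟨h⁻¹, inv_mem (Subgroup.mem_zpowers h)⟩).re ≠ (θ 1).re) :
    ∃ (β u : (MonoidAlgebra ℤ G)ˣ),
      IsBicyclicUnit (β : MonoidAlgebra ℤ G) ∧ IsBassCyclicUnit (u : MonoidAlgebra ℤ G) ∧
      ∃ T : ℕ, 0 < T ∧ ∀ t : ℕ, T ≤ t → IsFreePair u (β ^ t) := by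
  classical
  have := Fintype.ofFinite (Subgroup.zpowers h)
  set d := orderOf y with hd
  have hd0 : 0 < d := orderOf_pos y
  have hd6 : Nat.Coprime d 6 := hcop.coprime_dvd_left (orderOf_dvd_natCard y)
  have hd2 : Nat.Coprime 2 d := (hd6.coprime_dvd_right (by norm_num : 2 ∣ 6)).symm
  have hdodd : Odd d := Nat.coprime_two_left.1 hd2
  set hi : Subgroup.zpowers h := ⟨h⁻¹, inv_mem (Subgroup.mem_zpowers h)⟩ with hhi
  set σ : Subgroup.zpowers h → Subgroup.zpowers h := fun g => hi * g with hσ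
  set w₁ : Subgroup.zpowers h → ℂ := fun g => θ g - θ (σ g) with hw₁
  set r : Subgroup.zpowers h → ℝ := fun g => bassMu (θ g) with hr
  have htrans : ∀ S : Set (Subgroup.zpowers h), S.Nonempty → (∀ i ∈ S, σ i ∈ S) → ∀ i, i ∈ S := by
    rintro S ⟨s, hs⟩ hS i
    have h1 : ∀ n : ℕ, hi ^ n * s ∈ S := by
      intro n
      induction n with
      | zero => simpa using hs
      | succ n ih =>
        have := hS _ ih
        simpa only [hσ, pow_succ', mul_assoc] using this
    have h2 : ((i * s⁻¹ : Subgroup.zpowers h) : G) ∈ Subgroup.zpowers h⁻¹ := by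
      rw [Subgroup.zpowers_inv]; exact (i * s⁻¹).2
    rw [← mem_powers_iff_mem_zpowers] at h2
    obtain ⟨n, hn⟩ := h2
    have h3 : hi ^ n = i * s⁻¹ := Subtype.ext hn
    have := h1 n
    rwa [h3, inv_mul_cancel_right] at this
  have hRe : ∃ i, (θ (σ i)).re ≠ (θ i).re := ⟨1, by simpa [hσ] using hre⟩
  obtain ⟨gM, hgM⟩ := Finite.exists_max r
  obtain ⟨gm, hgm⟩ := Finite.exists_min r
  have hm0 : 0 < r gm := bassMu_pos hd6 (hθd gm)
  have hM0 : 0 < r gM := bassMu_pos hd6 (hθd gM)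
  have hK : (∑ i with r i = r gM, w₁ i) ≠ 0 :=
    extremal_coeff_ne_zero σ θ d p hd0.ne' hd6 hp hθd hθp htrans hRe 1 (r gM) (Or.inl rfl)
      (fun i => by simpa using hgM i) ⟨gM, rfl⟩
  have hK' : (∑ i with r i = r gm, w₁ i) ≠ 0 :=
    extremal_coeff_ne_zero σ θ d p hd0.ne' hd6 hp hθd hθp htrans hRe (-1) (r gm) (Or.inr rfl)
      (fun i => by simpa using hgm i) ⟨gm, rfl⟩
  obtain ⟨c₀, hc₀, N₀, hN₀⟩ := dominant_both w₁ r (r gM) (r gm) hm0 hM0 hgm hgM hK hK'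
  have htot : 0 < d.totient := Nat.totient_pos.2 hd0
  obtain ⟨m, hm⟩ : ∃ m, m = 2 * d * (d.totient * (N₀ + 1)) := ⟨_, rfl⟩
  have hmN : N₀ ≤ m := by
    rw [hm]
    have : 0 < 2 * d * d.totient := by positivity
    nlinarith
  have hmpos : 0 < m := by rw [hm]; positivity
  have hmdvd : d.totient ∣ m := ⟨2 * d * (N₀ + 1), by rw [hm]; ring⟩
  have hdv : (d : ℤ) ∣ 1 - 2 ^ m := by
    obtain ⟨q, hq⟩ := hmdvd
    rw [hq]
    have h1 := (Nat.ModEq.pow_totient hd2).pow q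
    rw [one_pow, ← pow_mul] at h1
    have h2 := h1.dvd
    push_cast at h2
    exact h2
  obtain ⟨u, hu⟩ := bass_isUnit y m hdodd hmdvd
  obtain ⟨β, hβ, hβn⟩ := exists_unipotent_unit
    ((1 - MonoidAlgebra.of ℤ G h) * MonoidAlgebra.of ℤ G y * hat h) (by
      have : (1 - MonoidAlgebra.of ℤ G h) * MonoidAlgebra.of ℤ G y * hat h *
          ((1 - MonoidAlgebra.of ℤ G h) * MonoidAlgebra.of ℤ G y * hat h) =
          (1 - MonoidAlgebra.of ℤ G h) * MonoidAlgebra.of ℤ G y *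
          (hat h * (1 - MonoidAlgebra.of ℤ G h)) * MonoidAlgebra.of ℤ G y * hat h := by
        simp only [mul_assoc]
      rw [this, hat_mul_one_sub]; simp)
  refine ⟨β, u, ⟨y, h, Or.inl hβ⟩, ⟨y, 2, m, by norm_num, hmpos, hd2, hmdvd, hu⟩, ?_⟩
  let _ : MulAction (MonoidAlgebra ℤ G)ˣ (G → ℂ) :=
    { smul := fun a f => regRep G (a : MonoidAlgebra ℤ G) f
      one_smul := fun f => by
        change regRep G ((1 : (MonoidAlgebra ℤ G)ˣ) : MonoidAlgebra ℤ G) f = f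
        simp
      mul_smul := fun a b f => by
        change regRep G ((a * b : (MonoidAlgebra ℤ G)ˣ) : MonoidAlgebra ℤ G) f =
          regRep G (a : MonoidAlgebra ℤ G) (regRep G (b : MonoidAlgebra ℤ G) f)
        simp }
  have hsmul : ∀ (a : (MonoidAlgebra ℤ G)ˣ) (f : G → ℂ),
      a • f = regRep G (a : MonoidAlgebra ℤ G) f := fun _ _ => rfl
  have hy : ∀ f ∈ covFun χ, ∀ g : Subgroup.zpowers h,
      regRep G (MonoidAlgebra.of ℤ G y) f g = θ g * f g :=
    fun f hf g => regRep_y hmem hθ hf g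
  have hlam : ∀ g : Subgroup.zpowers h, ∀ f ∈ covFun χ,
      regRep G (u : MonoidAlgebra ℤ G) f g = ((r g ^ m : ℝ) : ℂ) * f g := by
    intro g f hf
    rw [hu, regRep_bass y m g (θ g) (fun f hf => hy f hf g) hf,
      bass_eigenvalue hd0 (hθd g) hm hdv]
  have hrpos : ∀ g, 0 < r g := fun g => bassMu_pos hd6 (hθd g)
  obtain ⟨w0, hw0, hw01⟩ := exists_w0 χ h hχ
  let ev : (G → ℂ) → (Subgroup.zpowers h → ℂ) := fun f g => f g
  let φ : (Subgroup.zpowers h → ℂ) →ₗ[ℂ] ℂ :=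
    { toFun := fun e => ∑ g, e g
      map_add' := fun a b => by simp [Finset.sum_add_distrib]
      map_smul' := fun c a => by simp [Finset.mul_sum] }
  let D : ℤ → (Subgroup.zpowers h → ℂ) →ₗ[ℂ] (Subgroup.zpowers h → ℂ) := fun n =>
    { toFun := fun e g => (((r g ^ m : ℝ) : ℂ)) ^ n * e g
      map_add' := fun a b => by funext g; simp [mul_add]
      map_smul' := fun c a => by funext g; simp; ring }
  let L : ℤ → ℝ := fun n => if 0 ≤ n then ((r gM) ^ m) ^ n else ((r gm) ^ m) ^ n
  refine freePair_of_transvection u β (covFun χ : Set (G → ℂ)) ev φ w₁ D L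
    (Fintype.card (Subgroup.zpowers h)) c₀ ?_ ?_ ?_ ?_ ?_ ?_ ?_ ?_ ?_ hc₀ ?_
    (regRep G ((1 - MonoidAlgebra.of ℤ G h) * MonoidAlgebra.of ℤ G y * 1) w0) ?_ ?_
  · intro n x hx
    exact regRep_mem hx _
  · intro n x hx
    exact regRep_mem hx _
  · intro n f hf
    rw [hsmul, hβn]
    funext g
    change regRep G _ f g = f g + _
    rw [map_add, map_one, map_zsmul, LinearMap.add_apply, Pi.add_apply, LinearMap.smul_apply,
      Pi.smul_apply, regRep_bicyclic hy hf _ (hat h) (regRep_hat h f) g, Module.End.one_apply,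
      zsmul_eq_mul, ← mul_assoc]
    rfl
  · intro n f hf
    rw [hsmul]
    funext g
    exact regRep_unit_zpow u g _ (by
      have := pow_pos (hrpos g) m
      exact_mod_cast this.ne') (hlam g) n f hf
  · change ∑ g, (θ g - θ (hi * g)) = 0
    rw [Finset.sum_sub_distrib, sub_eq_zero]
    exact (Fintype.sum_equiv (Equiv.mulLeft hi) _ _ (fun g => rfl)).symm
  · exact_mod_cast Fintype.card_pos
  · intro e
    change ‖∑ g, e g‖ ≤ _
    refine (norm_sum_le _ _).trans ?_
    refine (Finset.sum_le_sum (fun g _ => norm_le_pi_norm e g)).trans ?_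
    simp
  · intro n
    simp only [L]
    split_ifs <;> positivity
  · intro n _ e
    have hLn : ∀ g, ((r g) ^ m) ^ n ≤ L n := fun g =>
      zpow_le_extremal (pow_pos hm0 m) (pow_le_pow_left₀ hm0.le (hgm g) m)
        (pow_le_pow_left₀ (hrpos g).le (hgM g) m) n
    have hL0 : 0 ≤ L n := (zpow_nonneg (pow_nonneg hM0.le m) n).trans (hLn gM)
    rw [pi_norm_le_iff_of_nonneg (by positivity)]
    intro g
    change ‖(((r g ^ m : ℝ) : ℂ)) ^ n * e g‖ ≤ _
    rw [norm_mul, norm_zpow, Complex.norm_real, Real.norm_of_nonneg (pow_nonneg (hrpos g).le m)]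
    exact mul_le_mul (hLn g) (norm_le_pi_norm e g) (norm_nonneg _) hL0
  · intro n hn
    have := hN₀ m hmN n hn
    refine this.trans (le_of_eq ?_)
    congr 1
    change _ = ∑ g, _
    refine Finset.sum_congr rfl (fun g _ => ?_)
    exact mul_comm _ _
  · exact regRep_mem hw0 _
  · funext g
    change regRep G _ w0 g = _
    rw [regRep_bicyclic hy hw0 1 1 (fun g => by simp [hw01 g]) g, one_mul]


/-- **Theorem 3.** If `G` is a finite non-abelian group of order coprime with `6`, then
`ℤG` has a bicyclic unit `β` and a Bass cyclic unit `u` such that `(u, βᵗ)` is a free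
pair for every sufficiently large positive integer `t`. -/
theorem bass_bicyclic_free_pair (G : Type*) [Group G] [Fintype G]
    (hnab : ∃ g₁ g₂ : G, g₁ * g₂ ≠ g₂ * g₁)
    (hcop : Nat.Coprime (Fintype.card G) 6) :
    ∃ (β u : (MonoidAlgebra ℤ G)ˣ),
      IsBicyclicUnit (β : MonoidAlgebra ℤ G) ∧ IsBassCyclicUnit (u : MonoidAlgebra ℤ G) ∧
      ∃ T : ℕ, 0 < T ∧ ∀ t : ℕ, T ≤ t → IsFreePair u (β ^ t) := by
  have hcop' : Nat.Coprime (Nat.card G) 6 := by rwa [Nat.card_eq_fintype_card]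
  have hodd : Odd (Nat.card G) :=
    Nat.coprime_two_right.1 (hcop'.coprime_dvd_right (by norm_num : 2 ∣ 6))
  obtain ⟨h, y, hg⟩ := exists_goodPair hnab hodd
  obtain ⟨y', p, A, hp, hA, hN, hy, hn, hyp⟩ := hg.refine
  obtain ⟨χ, hχ, θ, h1, h2, h3, h4, h5⟩ := exists_theta hodd hA hN hy hn hyp
  exact free_pair_of_theta hcop' hp χ hχ θ h1 h2 h3 h4 h5
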